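/- Sum rule for the renormalised Bethe vector: for every N ≥ 1 and all nonzero complex w₁,…,w_N such that w_j² ≠ w_k² and q²w_j² ≠ w_k² for all j ≠ k, the bilinear square norm Z(w₁,…,w_N) := Σ_{σ ∈ {⇑,0,⇓}^N} ⟨σ|Ψ̃(w₁⁻¹,…,w_N⁻¹)⟩ · ⟨σ|Ψ̃(w₁,…,w_N)⟩ equals [q²]^{−N} Z_IK(w₁,…,w_N; w₁,…,w_N), where Z_IK is the Izergin–Korepin determinant. -/

import Mathlib

open Matrix BigOperators Finset

noncomputable section

/-- `[z] = z - z⁻¹`. -/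
def br (z : ℂ) : ℂ := z - z⁻¹

/-- R-matrix `R^{(1,2)}(z)` on ℂ²⊗ℂ³; basis `(ε, σ)` with ε ∈ {0=↑,1=↓}, σ ∈ {0=⇑,1=0,2=⇓}. -/
def R12 (q c z : ℂ) : Matrix (Fin 2 × Fin 3) (Fin 2 × Fin 3) ℂ :=
  Matrix.of fun p p' =>
    if p = (0,0) ∧ p' = (0,0) then br (q^2*z)
    else if p = (0,1) ∧ p' = (0,1) then br (q*z)
    else if p = (0,2) ∧ p' = (0,2) then br z
    else if p = (1,0) ∧ p' = (1,0) then br z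
    else if p = (1,1) ∧ p' = (1,1) then br (q*z)
    else if p = (1,2) ∧ p' = (1,2) then br (q^2*z)
    else if p = (0,1) ∧ p' = (1,0) then c
    else if p = (0,2) ∧ p' = (1,1) then c
    else if p = (1,0) ∧ p' = (0,1) then c
    else if p = (1,1) ∧ p' = (0,2) then c
    else 0

/-- `R^{(1,2)}` acting on the auxiliary ℂ² and the j-th site of `(ℂ³)^{⊗N}`. -/
def R12at (q c z : ℂ) {N : ℕ} (j : Fin N) :
    Matrix (Fin 2 × (Fin N → Fin 3)) (Fin 2 × (Fin N → Fin 3)) ℂ :=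
  Matrix.of fun p p' =>
    R12 q c z (p.1, p.2 j) (p'.1, p'.2 j) *
      if ∀ k, k ≠ j → p.2 k = p'.2 k then 1 else 0

/-- Monodromy matrix `𝒯_a(z) = R^{(1,2)}_{a,N}(q⁻¹z/w_N) ⋯ R^{(1,2)}_{a,1}(q⁻¹z/w₁)`. -/
def monodromy (q c : ℂ) {N : ℕ} (w : Fin N → ℂ) (z : ℂ) :
    Matrix (Fin 2 × (Fin N → Fin 3)) (Fin 2 × (Fin N → Fin 3)) ℂ :=
  (((List.finRange N).reverse).map fun j => R12at q c (q⁻¹ * z / w j) j).prod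

/-- The operator 𝒜(z): auxiliary block (↑,↑) of the monodromy matrix. -/
def Aop (q c : ℂ) {N : ℕ} (w : Fin N → ℂ) (z : ℂ) :
    Matrix (Fin N → Fin 3) (Fin N → Fin 3) ℂ :=
  Matrix.of fun σ τ => monodromy q c w z (0, σ) (0, τ)

/-- The operator ℬ(z): auxiliary block (↑,↓) of the monodromy matrix. -/
def Bop (q c : ℂ) {N : ℕ} (w : Fin N → ℂ) (z : ℂ) :
    Matrix (Fin N → Fin 3) (Fin N → Fin 3) ℂ :=
  Matrix.of fun σ τ => monodromy q c w z (0, σ) (1, τ)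

/-- The operator 𝒟(z): auxiliary block (↓,↓) of the monodromy matrix. -/
def Dop (q c : ℂ) {N : ℕ} (w : Fin N → ℂ) (z : ℂ) :
    Matrix (Fin N → Fin 3) (Fin N → Fin 3) ℂ :=
  Matrix.of fun σ τ => monodromy q c w z (1, σ) (1, τ)

/-- Bethe reference state `|∧⟩ = |⇑…⇑⟩`. -/
def vac (N : ℕ) : (Fin N → Fin 3) → ℂ := fun σ => if σ = fun _ => 0 then 1 else 0

/-- Bethe vector `|Ψ(w₁,…,w_N)⟩ = ℬ(w₁)⋯ℬ(w_N)|∧⟩`. -/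
def bethe (q c : ℂ) {N : ℕ} (w : Fin N → ℂ) : (Fin N → Fin 3) → ℂ :=
  (((List.finRange N).map fun j => Bop q c w (w j)).prod).mulVec (vac N)

/-- Renormalised Bethe vector
`|Ψ̃(w₁,…,w_N)⟩ = c^{−N} (∏_{j<k} [q w_j/w_k])⁻¹ |Ψ(w₁,…,w_N)⟩`. -/
def betheTilde (q c : ℂ) {N : ℕ} (w : Fin N → ℂ) : (Fin N → Fin 3) → ℂ :=
  ((c ^ N)⁻¹ *
    (∏ pr ∈ Finset.univ.filter (fun pr : Fin N × Fin N => pr.1 < pr.2),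
      br (q * w pr.1 / w pr.2))⁻¹) • bethe q c w

/-- The Izergin–Korepin determinant `Z_IK(ζ₁,…,ζ_N; w₁,…,w_N)`. -/
def ZIK (q : ℂ) {N : ℕ} (ζ w : Fin N → ℂ) : ℂ :=
  ((∏ j, ∏ k, br (q * ζ j / w k) * br (q * w k / ζ j)) /
      ∏ pr ∈ Finset.univ.filter (fun pr : Fin N × Fin N => pr.1 < pr.2),
        (br (ζ pr.1 / ζ pr.2) * br (w pr.2 / w pr.1))) *
    Matrix.det (Matrix.of fun j k : Fin N =>
      br (q^2) / (br (q * ζ j / w k) * br (q * w k / ζ j)))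

section RTT
variable {R : Type*} [Ring R]

/-- The product `T_a S_b` of two operator-valued matrices acting on different auxiliary factors. -/
def auxMul (T S : Matrix (Fin 2) (Fin 2) R) : Matrix (Fin 2 × Fin 2) (Fin 2 × Fin 2) R :=
  Matrix.of fun p p' => T p.1 p'.1 * S p.2 p'.2

/-- The product `S_b T_a` of two operator-valued matrices acting on different auxiliary factors. -/
def auxMulRev (T S : Matrix (Fin 2) (Fin 2) R) : Matrix (Fin 2 × Fin 2) (Fin 2 × Fin 2) R :=
  Matrix.of fun p p' => S p.2 p'.2 * T p.1 p'.1

lemma auxMul_mul {L L' T S : Matrix (Fin 2) (Fin 2) R}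
    (h : ∀ i j k l, Commute (T i j) (L' k l)) :
    auxMul (L * T) (L' * S) = auxMul L L' * auxMul T S := by
  ext ⟨i, j⟩ ⟨k, l⟩
  simp only [auxMul, Matrix.of_apply, Matrix.mul_apply, Fintype.sum_prod_type, Finset.sum_mul_sum]
  refine Finset.sum_congr rfl fun m _ => Finset.sum_congr rfl fun n _ => ?_
  rw [mul_assoc, ← mul_assoc (T m k), (h m k j n).eq, mul_assoc, mul_assoc]

lemma auxMulRev_mul {L L' T S : Matrix (Fin 2) (Fin 2) R}
    (h : ∀ i j k l, Commute (S i j) (L k l)) :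
    auxMulRev (L * T) (L' * S) = auxMulRev L L' * auxMulRev T S := by
  ext ⟨i, j⟩ ⟨k, l⟩
  simp only [auxMulRev, Matrix.of_apply, Matrix.mul_apply, Fintype.sum_prod_type,
    Finset.sum_mul_sum]
  rw [Finset.sum_comm]
  refine Finset.sum_congr rfl fun m _ => Finset.sum_congr rfl fun n _ => ?_
  rw [mul_assoc, ← mul_assoc (S n l), (h n l i m).eq, mul_assoc, mul_assoc]

variable [Algebra ℂ R]

/-- The intertwining relation `r T_a S_b = S_b T_a r`. -/
def SatisfiesRTT (r : Matrix (Fin 2 × Fin 2) (Fin 2 × Fin 2) ℂ)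
    (T S : Matrix (Fin 2) (Fin 2) R) : Prop :=
  r.map (algebraMap ℂ R) * auxMul T S = auxMulRev T S * r.map (algebraMap ℂ R)

lemma SatisfiesRTT.mul {r : Matrix (Fin 2 × Fin 2) (Fin 2 × Fin 2) ℂ}
    {L L' T S : Matrix (Fin 2) (Fin 2) R} (hL : SatisfiesRTT r L L') (hT : SatisfiesRTT r T S)
    (h1 : ∀ i j k l, Commute (T i j) (L' k l)) (h2 : ∀ i j k l, Commute (S i j) (L k l)) :
    SatisfiesRTT r (L * T) (L' * S) := by
  unfold SatisfiesRTT at *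
  rw [auxMul_mul h1, auxMulRev_mul h2, ← mul_assoc, hL, mul_assoc, hT, mul_assoc]

lemma SatisfiesRTT.one (r : Matrix (Fin 2 × Fin 2) (Fin 2 × Fin 2) ℂ) :
    SatisfiesRTT r (1 : Matrix (Fin 2) (Fin 2) R) 1 := by
  have h1 : auxMul (1 : Matrix (Fin 2) (Fin 2) R) 1 = 1 := by
    ext ⟨i, j⟩ ⟨k, l⟩
    simp only [auxMul, Matrix.of_apply, Matrix.one_apply, Prod.mk.injEq]
    split_ifs <;> simp_all
  have h2 : auxMulRev (1 : Matrix (Fin 2) (Fin 2) R) 1 = 1 := by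
    ext ⟨i, j⟩ ⟨k, l⟩
    simp only [auxMulRev, Matrix.of_apply, Matrix.one_apply, Prod.mk.injEq]
    split_ifs <;> simp_all
  rw [SatisfiesRTT, h1, h2, mul_one, one_mul]

lemma SatisfiesRTT.map {R' : Type*} [Ring R'] [Algebra ℂ R'] (f : R →ₐ[ℂ] R')
    {r : Matrix (Fin 2 × Fin 2) (Fin 2 × Fin 2) ℂ} {T S : Matrix (Fin 2) (Fin 2) R}
    (h : SatisfiesRTT r T S) : SatisfiesRTT r (T.map f) (S.map f) := by
  have hmap := congrArg (fun M => M.map f) h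
  simp only [Matrix.map_mul] at hmap
  have e1 : (r.map (algebraMap ℂ R)).map f = r.map (algebraMap ℂ R') := by
    ext; simp
  have e2 : (auxMul T S).map f = auxMul (T.map f) (S.map f) := by
    ext; simp [auxMul]
  have e3 : (auxMulRev T S).map f = auxMulRev (T.map f) (S.map f) := by
    ext; simp [auxMulRev]
  rwa [e1, e2, e3] at hmap

/-- The six-vertex R-matrix `R^{(1,1)}(x)`. -/
def R11 (q x : ℂ) : Matrix (Fin 2 × Fin 2) (Fin 2 × Fin 2) ℂ :=
  Matrix.of fun p p' =>
    if p = p' then (if p.1 = p.2 then br (q * x) else br x)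
    else if p.1 = p'.2 ∧ p.2 = p'.1 then br q else 0

lemma satisfiesRTT_R11_iff (q x : ℂ) (T S : Matrix (Fin 2) (Fin 2) R) :
    SatisfiesRTT (R11 q x) T S ↔ ∀ i j k l,
      (if i = j then br (q * x) • (T i k * S j l)
        else br x • (T i k * S j l) + br q • (T j k * S i l)) =
      (if k = l then br (q * x) • (S j l * T i k)
        else br x • (S j l * T i k) + br q • (S j k * T i l)) := by
  rw [SatisfiesRTT, ← Matrix.ext_iff]
  simp only [Prod.forall, Fin.forall_fin_two]
  simp [Matrix.mul_apply, Fintype.sum_prod_type, R11, auxMul, auxMulRev, Algebra.smul_def,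
    Algebra.commutes, add_comm]

end RTT

section Site
variable {ι κ : Type*} [Fintype ι] [DecidableEq ι] [Fintype κ] [DecidableEq κ]

lemma sum_mul_ite_eq_off (j : ι) (σ : ι → κ) (f : (ι → κ) → ℂ) :
    ∑ τ, f τ * (if ∀ k, k ≠ j → σ k = τ k then 1 else 0) =
      ∑ s, f (Function.update σ j s) := by
  simp only [mul_ite, mul_one, mul_zero]
  rw [← Finset.sum_filter]
  refine Finset.sum_bij' (fun τ _ => τ j) (fun s _ => Function.update σ j s) ?_ ?_ ?_ ?_ ?_
  · simp
  · intro s _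
    simp +contextual
  · intro τ hτ
    simp only [Finset.mem_filter, Finset.mem_univ, true_and] at hτ
    ext k
    by_cases hk : k = j
    · subst hk; simp
    · simp [hk, hτ k hk]
  · simp
  · intro τ hτ
    simp only [Finset.mem_filter, Finset.mem_univ, true_and] at hτ
    congr 1
    ext k
    by_cases hk : k = j
    · subst hk; simp
    · simp [hk, hτ k hk]

/-- The action of a one-site operator on the `j`-th tensor factor. -/
def siteFun (j : ι) (M : Matrix κ κ ℂ) : Matrix (ι → κ) (ι → κ) ℂ :=
  Matrix.of fun σ τ => M (σ j) (τ j) * if ∀ k, k ≠ j → σ k = τ k then 1 else 0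

lemma siteFun_mul_apply (j : ι) (M : Matrix κ κ ℂ) (M' : Matrix (ι → κ) (ι → κ) ℂ)
    (σ ρ : ι → κ) :
    (siteFun j M * M') σ ρ = ∑ s, M (σ j) s * M' (Function.update σ j s) ρ := by
  have := sum_mul_ite_eq_off j σ (fun τ => M (σ j) (τ j) * M' τ ρ)
  simp only [Function.update_self] at this
  rw [← this, Matrix.mul_apply]
  refine Finset.sum_congr rfl fun τ _ => ?_
  simp only [siteFun, Matrix.of_apply]
  ring

/-- The action on the `j`-th tensor factor as an algebra homomorphism. -/
def site (j : ι) : Matrix κ κ ℂ →ₐ[ℂ] Matrix (ι → κ) (ι → κ) ℂ :=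
  AlgHom.ofLinearMap
    { toFun := siteFun j
      map_add' := fun M M' => by
        ext
        exact add_mul _ _ _
      map_smul' := fun a M => by
        ext; simp [siteFun] }
    (by
      ext σ τ
      simp only [LinearMap.coe_mk, AddHom.coe_mk, siteFun, Matrix.of_apply, Matrix.one_apply]
      by_cases h : σ = τ
      · simp [h]
      · rw [if_neg h]
        by_cases hj : σ j = τ j
        · have : ¬ ∀ k, k ≠ j → σ k = τ k := fun hk => h (funext fun k => by
            by_cases e : k = j
            · rw [e, hj]
            · exact hk k e)
          simp [this]
        · simp [hj])
    (by
      intro M M'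
      ext σ ρ
      simp only [LinearMap.coe_mk, AddHom.coe_mk]
      rw [siteFun_mul_apply]
      have hs : ∀ s : κ, (∀ k, k ≠ j → Function.update σ j s k = ρ k) ↔
          ∀ k, k ≠ j → σ k = ρ k := fun s =>
        forall_congr' fun k => imp_congr_right fun hk => by rw [Function.update_of_ne hk]
      simp only [siteFun, Matrix.of_apply, Function.update_self, hs, Matrix.mul_apply,
        Finset.sum_mul, mul_assoc])

lemma site_apply (j : ι) (M : Matrix κ κ ℂ) (σ τ : ι → κ) :
    site j M σ τ = M (σ j) (τ j) * if ∀ k, k ≠ j → σ k = τ k then 1 else 0 := rfl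

lemma site_commute {j k : ι} (hjk : j ≠ k) (M M' : Matrix κ κ ℂ) :
    Commute (site j M) (site k M') := by
  have key : ∀ {j k : ι} (_ : j ≠ k) (M M' : Matrix κ κ ℂ) (σ ρ : ι → κ),
      (site j M * site k M') σ ρ =
        M (σ j) (ρ j) * M' (σ k) (ρ k) *
          if ∀ l, l ≠ j → l ≠ k → σ l = ρ l then 1 else 0 := by
    intro j k hjk M M' σ ρ
    change (siteFun j M * siteFun k M') σ ρ = _
    rw [siteFun_mul_apply, Finset.sum_eq_single (ρ j)]
    · simp only [siteFun, Matrix.of_apply, Function.update_of_ne hjk.symm, mul_assoc]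
      congr 3
      refine propext ⟨fun h l h1 h2 => ?_, fun h l h1 => ?_⟩
      · simpa [h1] using h l h2
      · by_cases e : l = j
        · subst e; simp
        · simpa [e] using h l e h1
    · intro s _ hs
      have : ¬ ∀ l, l ≠ k → Function.update σ j s l = ρ l := fun h => hs (by
        simpa using h j hjk)
      simp [siteFun, this]
    · simp
  ext σ ρ
  rw [key hjk, key hjk.symm, mul_comm (M _ _)]
  congr 3
  exact propext ⟨fun h l h1 h2 => h l h2 h1, fun h l h1 h2 => h l h2 h1⟩

end Site

lemma br_inv (z : ℂ) : br z⁻¹ = -br z := by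
  simp [br]

lemma br_one : br 1 = 0 := by
  simp [br]

lemma br_ne_zero {z : ℂ} (hz : z ≠ 0) (h : z ^ 2 ≠ 1) : br z ≠ 0 := by
  intro h0
  apply h
  have h1 : z = z⁻¹ := sub_eq_zero.mp h0
  rw [sq]
  nth_rewrite 1 [h1]
  exact inv_mul_cancel₀ hz

/-- `R^{(1,2)}(z)` as a `2 × 2` matrix of operators on ℂ³. -/
def lax (q c z : ℂ) : Matrix (Fin 2) (Fin 2) (Matrix (Fin 3) (Fin 3) ℂ) :=
  (Matrix.compRingEquiv (Fin 2) (Fin 3) ℂ).symm (R12 q c z)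

lemma lax_eq (q c z : ℂ) : lax q c z =
    !![!![br (q ^ 2 * z), 0, 0; 0, br (q * z), 0; 0, 0, br z],
       !![0, 0, 0; c, 0, 0; 0, c, 0];
       !![0, c, 0; 0, 0, c; 0, 0, 0],
       !![br z, 0, 0; 0, br (q * z), 0; 0, 0, br (q ^ 2 * z)]] := by
  ext a b s t
  fin_cases a <;> fin_cases b <;> fin_cases s <;> fin_cases t <;>
    simp [lax, R12]

lemma satisfiesRTT_lax {q c z z' : ℂ} (hq : q ≠ 0) (hc : c ^ 2 = br q * br (q ^ 2))
    (hz : z ≠ 0) (hz' : z' ≠ 0) :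
    SatisfiesRTT (R11 q (z / z')) (lax q c z) (lax q c z') := by
  have hc' : c * c = br q * br (q ^ 2) := by rw [← hc, sq]
  rw [satisfiesRTT_R11_iff]
  simp only [lax_eq, Fin.forall_fin_two]
  simp [hc']
  refine ⟨⟨⟨⟨?_, ?_⟩, ?_⟩, ⟨?_, ?_, ?_⟩, ?_⟩, ⟨⟨?_, ?_, ?_⟩, ?_⟩, ?_, ?_⟩ <;>
  (repeat' apply And.intro) <;>
  first
  | exact Or.inl (mul_comm _ _)
  | (ext i; fin_cases i <;> rfl)
  | (simp only [br]; field_simp; ring)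

section Monodromy
variable {N : ℕ} (q c : ℂ) (w : Fin N → ℂ)

/-- The partial monodromy matrix over the sites in the list `l`, as a `2 × 2` block matrix. -/
def monoBlock (l : List (Fin N)) (z : ℂ) :
    Matrix (Fin 2) (Fin 2) (Matrix (Fin N → Fin 3) (Fin N → Fin 3) ℂ) :=
  (l.map fun j => (lax q c (q⁻¹ * z / w j)).map (site j)).prod

lemma monoBlock_nil (z : ℂ) : monoBlock q c w [] z = 1 := rfl

lemma monoBlock_cons (j : Fin N) (l : List (Fin N)) (z : ℂ) :
    monoBlock q c w (j :: l) z =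
      (lax q c (q⁻¹ * z / w j)).map (site j) * monoBlock q c w l z := by
  simp [monoBlock]

lemma monodromy_eq_monoBlock (z : ℂ) (a b : Fin 2) (σ τ : Fin N → Fin 3) :
    monodromy q c w z (a, σ) (b, τ) =
      monoBlock q c w (List.finRange N).reverse z a b σ τ := by
  have h : (Matrix.compRingEquiv (Fin 2) (Fin N → Fin 3) ℂ).symm (monodromy q c w z) =
      monoBlock q c w (List.finRange N).reverse z := by
    rw [monodromy, monoBlock, map_list_prod, List.map_map]
    congr 1
    refine List.map_congr_left fun j _ => ?_
    ext a b σ τ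
    simp only [Function.comp_apply, Matrix.map_apply, site_apply, R12at]
    change R12 q c _ _ _ * _ = R12 q c _ _ _ * _
    congr
  rw [← h]
  rfl

/-- The operator `𝒞(z)`: auxiliary block (↓,↑) of the monodromy matrix. -/
def Cop (z : ℂ) : Matrix (Fin N → Fin 3) (Fin N → Fin 3) ℂ :=
  Matrix.of fun σ τ => monodromy q c w z (1, σ) (0, τ)

lemma Aop_eq (z : ℂ) : Aop q c w z = monoBlock q c w (List.finRange N).reverse z 0 0 := by
  ext σ τ
  exact monodromy_eq_monoBlock ..

lemma Bop_eq (z : ℂ) : Bop q c w z = monoBlock q c w (List.finRange N).reverse z 0 1 := by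
  ext σ τ
  exact monodromy_eq_monoBlock ..

lemma Cop_eq (z : ℂ) : Cop q c w z = monoBlock q c w (List.finRange N).reverse z 1 0 := by
  ext σ τ
  exact monodromy_eq_monoBlock ..

lemma Dop_eq (z : ℂ) : Dop q c w z = monoBlock q c w (List.finRange N).reverse z 1 1 := by
  ext σ τ
  exact monodromy_eq_monoBlock ..

lemma site_commute_monoBlock {j : Fin N} {l : List (Fin N)} (hj : j ∉ l) (z : ℂ)
    (M : Matrix (Fin 3) (Fin 3) ℂ) (a b : Fin 2) :
    Commute (site j M) (monoBlock q c w l z a b) := by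
  induction l generalizing a b with
  | nil =>
    rw [monoBlock_nil, Matrix.one_apply]
    split_ifs
    · exact Commute.one_right _
    · exact Commute.zero_right _
  | cons k l ih =>
    rw [List.mem_cons, not_or] at hj
    rw [monoBlock_cons, Matrix.mul_apply]
    refine Commute.sum_right _ _ _ fun i _ => Commute.mul_right ?_ (ih hj.2 _ _)
    exact site_commute hj.1 _ _

variable {q c w}

lemma satisfiesRTT_monoBlock (hq : q ≠ 0) (hc : c ^ 2 = br q * br (q ^ 2))
    (hw : ∀ j, w j ≠ 0) {x y : ℂ} (hx : x ≠ 0) (hy : y ≠ 0) {l : List (Fin N)}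
    (hl : l.Nodup) :
    SatisfiesRTT (R11 q (x / y)) (monoBlock q c w l x) (monoBlock q c w l y) := by
  induction l with
  | nil => exact SatisfiesRTT.one _
  | cons j l ih =>
    rw [List.nodup_cons] at hl
    rw [monoBlock_cons, monoBlock_cons]
    refine SatisfiesRTT.mul ?_ (ih hl.2) ?_ ?_
    · have hr : x / y = (q⁻¹ * x / w j) / (q⁻¹ * y / w j) := by
        have := hw j
        field_simp
      have h := satisfiesRTT_lax hq hc (div_ne_zero (mul_ne_zero (inv_ne_zero hq) hx) (hw j))
        (div_ne_zero (mul_ne_zero (inv_ne_zero hq) hy) (hw j))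
      rw [← hr] at h
      have h2 := SatisfiesRTT.map (site (ι := Fin N) j) h
      exact h2
    · exact fun a b a' b' => (site_commute_monoBlock q c w hl.1 _ _ _ _).symm
    · exact fun a b a' b' => (site_commute_monoBlock q c w hl.1 _ _ _ _).symm

lemma rtt_relations (hq : q ≠ 0) (hc : c ^ 2 = br q * br (q ^ 2))
    (hw : ∀ j, w j ≠ 0) {x y : ℂ} (hx : x ≠ 0) (hy : y ≠ 0) (i j k l : Fin 2) :
    (if i = j then br (q * (x / y)) • (monoBlock q c w (List.finRange N).reverse x i k *
          monoBlock q c w (List.finRange N).reverse y j l)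
      else br (x / y) • (monoBlock q c w (List.finRange N).reverse x i k *
          monoBlock q c w (List.finRange N).reverse y j l) +
        br q • (monoBlock q c w (List.finRange N).reverse x j k *
          monoBlock q c w (List.finRange N).reverse y i l)) =
    (if k = l then br (q * (x / y)) • (monoBlock q c w (List.finRange N).reverse y j l *
          monoBlock q c w (List.finRange N).reverse x i k)
      else br (x / y) • (monoBlock q c w (List.finRange N).reverse y j l *
          monoBlock q c w (List.finRange N).reverse x i k) +
        br q • (monoBlock q c w (List.finRange N).reverse y j k *
          monoBlock q c w (List.finRange N).reverse x i l)) :=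
  (satisfiesRTT_R11_iff q (x / y) _ _).1 (satisfiesRTT_monoBlock hq hc hw hx hy
    (List.nodup_reverse.2 (List.nodup_finRange N))) i j k l

lemma Bop_comm (hq : q ≠ 0) (hq4 : q ^ 4 ≠ 1) (hc : c ^ 2 = br q * br (q ^ 2))
    (hw : ∀ j, w j ≠ 0) {x y : ℂ} (hx : x ≠ 0) (hy : y ≠ 0) :
    Bop q c w x * Bop q c w y = Bop q c w y * Bop q c w x := by
  have h1 := rtt_relations hq hc hw hx hy 0 0 1 1
  have h2 := rtt_relations hq hc hw hy hx 0 0 1 1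
  simp only [if_true, ← Bop_eq] at h1 h2
  by_cases h : br (q * (x / y)) = 0
  · refine (smul_right_injective _ ?_ h2).symm
    apply br_ne_zero
    · positivity
    · intro h'
      apply hq4
      have h3 : (q * (x / y)) ^ 2 = 1 := by
        by_contra h3
        exact br_ne_zero (by positivity) h3 h
      calc q ^ 4 = (q * (x / y)) ^ 2 * (q * (y / x)) ^ 2 := by field_simp
        _ = 1 := by rw [h3, h', mul_one]
  · exact smul_right_injective _ h h1

lemma Aop_mul_Bop (hq : q ≠ 0) (hc : c ^ 2 = br q * br (q ^ 2))
    (hw : ∀ j, w j ≠ 0) {x y : ℂ} (hx : x ≠ 0) (hy : y ≠ 0) (hxy : br (x / y) ≠ 0) :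
    Aop q c w x * Bop q c w y =
      (br (q⁻¹ * x / y) / br (x / y)) • (Bop q c w y * Aop q c w x) -
        (br q⁻¹ / br (x / y)) • (Bop q c w x * Aop q c w y) := by
  have h := rtt_relations hq hc hw hy hx 0 0 1 0
  simp only [if_true, one_ne_zero, if_false, ← Bop_eq, ← Aop_eq] at h
  have e1 : br (y / x) = -br (x / y) := by rw [← br_inv, inv_div]
  have e2 : br (q * (y / x)) = -br (q⁻¹ * x / y) := by
    rw [← br_inv]; congr 1; field_simp
  rw [e1, e2] at h
  apply smul_right_injective _ hxy
  simp only [smul_sub, smul_smul, mul_div_cancel₀ _ hxy, br_inv]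
  linear_combination (norm := module) h

lemma Dop_mul_Bop (hq : q ≠ 0) (hc : c ^ 2 = br q * br (q ^ 2))
    (hw : ∀ j, w j ≠ 0) {x y : ℂ} (hx : x ≠ 0) (hy : y ≠ 0) (hxy : br (x / y) ≠ 0) :
    Dop q c w x * Bop q c w y =
      (br (q * x / y) / br (x / y)) • (Bop q c w y * Dop q c w x) -
        (br q / br (x / y)) • (Bop q c w x * Dop q c w y) := by
  have h := rtt_relations hq hc hw hx hy 1 0 1 1
  simp only [if_true, one_ne_zero, if_false, ← Bop_eq, ← Dop_eq] at h
  apply smul_right_injective _ hxy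
  simp only [smul_sub, smul_smul, mul_div_cancel₀ _ hxy, mul_div_assoc]
  linear_combination (norm := module) h

lemma Cop_mul_Bop (hq : q ≠ 0) (hc : c ^ 2 = br q * br (q ^ 2))
    (hw : ∀ j, w j ≠ 0) {x y : ℂ} (hx : x ≠ 0) (hy : y ≠ 0) (hxy : br (x / y) ≠ 0) :
    Cop q c w x * Bop q c w y = Bop q c w y * Cop q c w x +
      (br q / br (x / y)) • (Aop q c w y * Dop q c w x - Aop q c w x * Dop q c w y) := by
  have h := rtt_relations hq hc hw hx hy 1 0 0 1
  simp only [zero_ne_one, one_ne_zero, if_false, ← Bop_eq, ← Dop_eq, ← Aop_eq, ← Cop_eq] at h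
  apply smul_right_injective _ hxy
  simp only [smul_sub, smul_add, smul_smul, mul_div_cancel₀ _ hxy]
  linear_combination (norm := module) h

lemma site_mulVec_vac (j : Fin N) {M : Matrix (Fin 3) (Fin 3) ℂ} {a : ℂ}
    (h : ∀ s, M s 0 = if s = 0 then a else 0) :
    site j M *ᵥ vac N = a • vac N := by
  ext σ
  simp only [Matrix.mulVec, dotProduct, vac, mul_ite, mul_one, mul_zero, Finset.sum_ite_eq',
    Finset.mem_univ, if_true, site_apply, h, Pi.smul_apply, smul_eq_mul]
  by_cases hσ : σ = fun _ => 0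
  · simp [hσ]
  · rw [if_neg hσ]
    by_cases hj : σ j = 0
    · rw [if_neg]
      intro hk
      exact hσ (funext fun k => by
        by_cases e : k = j
        · rw [e, hj]
        · exact hk k e)
    · simp [hj]

lemma monoBlock_mulVec_vac (hq : q ≠ 0) {l : List (Fin N)} (hl : l.Nodup) (z : ℂ) :
    monoBlock q c w l z 0 0 *ᵥ vac N = (l.map fun j => br (q * z / w j)).prod • vac N ∧
    monoBlock q c w l z 1 0 *ᵥ vac N = 0 ∧
    monoBlock q c w l z 1 1 *ᵥ vac N = (l.map fun j => br (q⁻¹ * z / w j)).prod • vac N := by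
  induction l with
  | nil => simp [monoBlock_nil]
  | cons j l ih =>
    obtain ⟨hj, hl⟩ := List.nodup_cons.1 hl
    obtain ⟨hA, hC, hD⟩ := ih hl
    have hLA : site j (lax q c (q⁻¹ * z / w j) 0 0) *ᵥ vac N = br (q * z / w j) • vac N := by
      have e : q * z / w j = q ^ 2 * (q⁻¹ * z / w j) := by field_simp
      rw [e]
      refine site_mulVec_vac j fun s => ?_
      fin_cases s <;> simp [lax_eq]
    have hLC : site j (lax q c (q⁻¹ * z / w j) 1 0) *ᵥ vac N = 0 := by
      rw [← zero_smul ℂ (vac N)]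
      refine site_mulVec_vac j fun s => ?_
      fin_cases s <;> simp [lax_eq]
    have hLD : site j (lax q c (q⁻¹ * z / w j) 1 1) *ᵥ vac N = br (q⁻¹ * z / w j) • vac N := by
      refine site_mulVec_vac j fun s => ?_
      fin_cases s <;> simp [lax_eq]
    simp only [monoBlock_cons, Matrix.mul_apply, Fin.sum_univ_two, Matrix.map_apply,
      Matrix.add_mulVec, List.map_cons, List.prod_cons]
    refine ⟨?_, ?_, ?_⟩
    · rw [← mulVec_mulVec, ← mulVec_mulVec, hA, hC, mulVec_smul, hLA, mulVec_zero, add_zero,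
        smul_smul, mul_comm]
    · rw [← mulVec_mulVec, ← mulVec_mulVec, hA, hC, mulVec_smul, hLC, mulVec_zero, add_zero,
        smul_zero]
    · rw [(site_commute_monoBlock q c w hj z _ 0 1).eq, ← mulVec_mulVec, ← mulVec_mulVec, hLC,
        hD, mulVec_smul, hLD, mulVec_zero, zero_add, smul_smul, mul_comm]

lemma Aop_mulVec_vac (hq : q ≠ 0) (z : ℂ) :
    Aop q c w z *ᵥ vac N = (∏ j, br (q * z / w j)) • vac N := by
  rw [Aop_eq, (monoBlock_mulVec_vac hq (List.nodup_reverse.2 (List.nodup_finRange N)) z).1,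
    List.map_reverse, List.prod_reverse, ← List.ofFn_eq_map, List.prod_ofFn]

lemma Cop_mulVec_vac (hq : q ≠ 0) (z : ℂ) : Cop q c w z *ᵥ vac N = 0 := by
  rw [Cop_eq, (monoBlock_mulVec_vac hq (List.nodup_reverse.2 (List.nodup_finRange N)) z).2.1]

lemma Dop_mulVec_vac (hq : q ≠ 0) (z : ℂ) :
    Dop q c w z *ᵥ vac N = (∏ j, br (q⁻¹ * z / w j)) • vac N := by
  rw [Dop_eq, (monoBlock_mulVec_vac hq (List.nodup_reverse.2 (List.nodup_finRange N)) z).2.2,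
    List.map_reverse, List.prod_reverse, ← List.ofFn_eq_map, List.prod_ofFn]

lemma site_transpose (j : Fin N) (M : Matrix (Fin 3) (Fin 3) ℂ) :
    site j Mᵀ = (site j M : Matrix (Fin N → Fin 3) (Fin N → Fin 3) ℂ)ᵀ := by
  ext σ τ
  simp only [site_apply, Matrix.transpose_apply]
  congr 3
  exact propext (forall₂_congr fun k _ => eq_comm)

lemma monoBlock_crossing (hq : q ≠ 0) {l : List (Fin N)} (hl : l.Nodup) (z : ℂ) :
    monoBlock q c (fun j => (w j)⁻¹) l z⁻¹ 0 0 =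
      (-1 : ℂ) ^ l.length • (monoBlock q c w l z 1 1)ᵀ ∧
    monoBlock q c (fun j => (w j)⁻¹) l z⁻¹ 0 1 =
      (-1 : ℂ) ^ (l.length + 1) • (monoBlock q c w l z 1 0)ᵀ ∧
    monoBlock q c (fun j => (w j)⁻¹) l z⁻¹ 1 0 =
      (-1 : ℂ) ^ (l.length + 1) • (monoBlock q c w l z 0 1)ᵀ ∧
    monoBlock q c (fun j => (w j)⁻¹) l z⁻¹ 1 1 =
      (-1 : ℂ) ^ l.length • (monoBlock q c w l z 0 0)ᵀ := by
  induction l with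
  | nil => simp [monoBlock_nil]
  | cons j l ih =>
    obtain ⟨hj, hl⟩ := List.nodup_cons.1 hl
    obtain ⟨hA, hB, hC, hD⟩ := ih hl
    set x := q⁻¹ * z / w j with hx
    set x' := q⁻¹ * z⁻¹ / (w j)⁻¹ with hx'
    have b0 : br (q ^ 2 * x') = -br x := by
      rw [← br_inv]; congr 1; rw [hx, hx']; field_simp
    have b1 : br (q * x') = -br (q * x) := by
      rw [← br_inv]; congr 1; rw [hx, hx']; field_simp
    have b2 : br x' = -br (q ^ 2 * x) := by
      rw [← br_inv]; congr 1; rw [hx, hx']; field_simp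
    have l00 : lax q c x' 0 0 = -(lax q c x 1 1)ᵀ := by
      ext s t; fin_cases s <;> fin_cases t <;> simp [lax_eq, b0, b1, b2]
    have l01 : lax q c x' 0 1 = (lax q c x 1 0)ᵀ := by
      ext s t; fin_cases s <;> fin_cases t <;> simp [lax_eq]
    have l10 : lax q c x' 1 0 = (lax q c x 0 1)ᵀ := by
      ext s t; fin_cases s <;> fin_cases t <;> simp [lax_eq]
    have l11 : lax q c x' 1 1 = -(lax q c x 0 0)ᵀ := by
      ext s t; fin_cases s <;> fin_cases t <;> simp [lax_eq, b0, b1, b2]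
    have comm := fun M a b => (site_commute_monoBlock q c w hj z M a b).eq
    simp only [monoBlock_cons, Matrix.mul_apply, Fin.sum_univ_two, Matrix.map_apply,
      Matrix.transpose_add, Matrix.transpose_mul, ← hx, ← hx', hA, hB, hC, hD, l00, l01, l10,
      l11, comm, map_neg, site_transpose, List.length_cons]
    refine ⟨?_, ?_, ?_, ?_⟩ <;>
    · simp only [pow_succ, mul_smul_comm, neg_mul, smul_add, mul_neg, mul_one, neg_smul, neg_neg]
      module

lemma Bop_inv (hq : q ≠ 0) (z : ℂ) : Bop q c (fun j => (w j)⁻¹) z⁻¹ =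
    (-1 : ℂ) ^ (N + 1) • (Cop q c w z)ᵀ := by
  have h := (monoBlock_crossing (c := c) (w := w) hq
    (List.nodup_reverse.2 (List.nodup_finRange N)) z).2.1
  simpa [Bop_eq, Cop_eq] using h

lemma Aop_inv (hq : q ≠ 0) (z : ℂ) : Aop q c (fun j => (w j)⁻¹) z⁻¹ =
    (-1 : ℂ) ^ N • (Dop q c w z)ᵀ := by
  have h := (monoBlock_crossing (c := c) (w := w) hq
    (List.nodup_reverse.2 (List.nodup_finRange N)) z).1
  simpa [Aop_eq, Dop_eq] using h

lemma Dop_inv (hq : q ≠ 0) (z : ℂ) : Dop q c (fun j => (w j)⁻¹) z⁻¹ =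
    (-1 : ℂ) ^ N • (Aop q c w z)ᵀ := by
  have h := (monoBlock_crossing (c := c) (w := w) hq
    (List.nodup_reverse.2 (List.nodup_finRange N)) z).2.2.2
  simpa [Aop_eq, Dop_eq] using h

end Monodromy

section Action
variable {E : Type*} [AddCommGroup E] [Module ℂ E] (B : ℂˣ → Module.End ℂ E)
  (hB : ∀ x y, Commute (B x) (B y)) (Ω : E)

/-- The vector `∏_{u ∈ s} B(u) Ω` for commuting creation operators `B(u)`. -/
def offShell (s : Finset ℂˣ) : E :=
  s.noncommProd B (Set.Pairwise.mono (Set.subset_univ _) fun x _ y _ _ => hB x y) Ω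

lemma offShell_empty : offShell B hB Ω ∅ = Ω := by
  rw [offShell, Finset.noncommProd_empty, Module.End.one_apply]

variable {B}

lemma offShell_insert {x : ℂˣ} {s : Finset ℂˣ} (hx : x ∉ s) :
    offShell B hB Ω (insert x s) = B x (offShell B hB Ω s) := by
  rw [offShell, Finset.noncommProd_insert_of_notMem _ _ _ _ hx, Module.End.mul_apply, offShell]

variable {Ω} {T : ℂˣ → Module.End ℂ E} {t : ℂˣ → ℂ} {p : ℂ}

lemma br_exchange {p z x u : ℂ} (hp : p ≠ 0) (hz : z ≠ 0) (hx : x ≠ 0) (hu : u ≠ 0) :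
    br (p * z / x) * br (u / x) - br p * br (u / z) = br (p * u / x) * br (z / x) := by
  simp only [br]
  field_simp
  ring

lemma action_offShell (hp : p ≠ 0)
    (hT : ∀ x y : ℂˣ, br ((x : ℂ) / y) ≠ 0 → ∀ e, T x (B y e) =
      (br (p * x / y) / br ((x : ℂ) / y)) • B y (T x e) -
        (br p / br ((x : ℂ) / y)) • B x (T y e))
    (hΩ : ∀ x, T x Ω = t x • Ω) (s : Finset ℂˣ) (z : ℂˣ) (hz : z ∉ s)
    (hs : ∀ u ∈ insert z s, ∀ v ∈ insert z s, u ≠ v → br ((u : ℂ) / v) ≠ 0) :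
    T z (offShell B hB Ω s) = ∑ u ∈ insert z s,
      (t u * ((∏ v ∈ s, br (p * u / v)) / ∏ v ∈ (insert z s).erase u, br ((u : ℂ) / v))) •
        offShell B hB Ω ((insert z s).erase u) := by
  induction s using Finset.induction_on generalizing z with
  | empty => simp [offShell_empty, hΩ]
  | insert x s hx ih =>
    rw [Finset.mem_insert, not_or] at hz
    obtain ⟨hzx, hzs⟩ := hz
    have hxz : x ∉ insert z s := by simp [Ne.symm hzx, hx]
    have hz' : z ∉ insert x s := by simp [hzx, hzs]
    have ihz := ih z hzs fun u hu v hv => hs u (by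
      rw [Finset.insert_comm]; exact Finset.mem_insert_of_mem hu) v (by
      rw [Finset.insert_comm]; exact Finset.mem_insert_of_mem hv)
    have ihx := ih x hx fun u hu v hv => hs u (Finset.mem_insert_of_mem hu) v
      (Finset.mem_insert_of_mem hv)
    have hzx0 : br ((z : ℂ) / x) ≠ 0 := hs z (by simp) x (by simp) hzx
    have hxz0 : br ((x : ℂ) / z) = -br ((z : ℂ) / x) := by rw [← br_inv, inv_div]
    rw [offShell_insert hB Ω hx, hT z x hzx0, ihz, ihx, Finset.sum_insert hzs,
      Finset.sum_insert hx, Finset.sum_insert hz', Finset.sum_insert hx,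
      Finset.erase_insert hzs, Finset.erase_insert hx, Finset.erase_insert hz',
      Finset.erase_insert_of_ne hzx, Finset.erase_insert hx]
    simp only [map_add, map_smul, map_sum]
    rw [← offShell_insert hB Ω hx, ← offShell_insert hB Ω hzs, Finset.prod_insert hx,
      Finset.prod_insert hx, Finset.prod_insert hx, Finset.prod_insert hzs]
    have hsum : (br (p * z / x) / br ((z : ℂ) / x)) • ∑ u ∈ s,
          (t u * ((∏ v ∈ s, br (p * u / v)) / ∏ v ∈ (insert z s).erase u, br ((u : ℂ) / v))) •
            B x (offShell B hB Ω ((insert z s).erase u)) -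
        (br p / br ((z : ℂ) / x)) • ∑ u ∈ s,
          (t u * ((∏ v ∈ s, br (p * u / v)) / ∏ v ∈ (insert x s).erase u, br ((u : ℂ) / v))) •
            B z (offShell B hB Ω ((insert x s).erase u)) =
        ∑ u ∈ s, (t u * ((∏ v ∈ insert x s, br (p * u / v)) /
          ∏ v ∈ (insert z (insert x s)).erase u, br ((u : ℂ) / v))) •
            offShell B hB Ω ((insert z (insert x s)).erase u) := by
      rw [Finset.smul_sum, Finset.smul_sum, ← Finset.sum_sub_distrib]
      refine Finset.sum_congr rfl fun u hu => ?_
      have huz : z ≠ u := fun h => hzs (h ▸ hu)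
      have hux : x ≠ u := fun h => hx (h ▸ hu)
      have hx1 : x ∉ (insert z s).erase u := fun h => hxz (Finset.mem_of_mem_erase h)
      have hz1 : z ∉ (insert x s).erase u := fun h => hz' (Finset.mem_of_mem_erase h)
      have hx2 : x ∉ s.erase u := fun h => hx (Finset.mem_of_mem_erase h)
      have hz2 : z ∉ s.erase u := fun h => hzs (Finset.mem_of_mem_erase h)
      rw [← offShell_insert hB Ω hx1, ← offShell_insert hB Ω hz1,
        Finset.erase_insert_of_ne huz, Finset.erase_insert_of_ne huz,
        Finset.erase_insert_of_ne hux, Finset.insert_comm x z] at *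
      rw [smul_smul, smul_smul, ← sub_smul, Finset.prod_insert hx, Finset.prod_insert hz1,
        Finset.prod_insert hx2, Finset.prod_insert hz2]
      congr 1
      have h1 : br ((u : ℂ) / z) ≠ 0 := hs u (by simp [hu]) z (by simp) huz.symm
      have h2 : br ((u : ℂ) / x) ≠ 0 := hs u (by simp [hu]) x (by simp) hux.symm
      have h3 : ∏ v ∈ s.erase u, br ((u : ℂ) / v) ≠ 0 := Finset.prod_ne_zero_iff.2 fun v hv =>
        hs u (by simp [hu]) v (by simp [Finset.mem_of_mem_erase hv])
          (Finset.ne_of_mem_erase hv).symm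
      have key := br_exchange hp z.ne_zero x.ne_zero u.ne_zero
      field_simp
      linear_combination (t u * ∏ v ∈ s, br (p * u / v)) * key
    rw [← hsum, hxz0]
    have e1 : p * x / x = p := mul_div_cancel_right₀ _ x.ne_zero
    have e2 : t x * (br (p * x / x) * (∏ v ∈ s, br (p * x / v)) /
        (-br ((z : ℂ) / x) * ∏ v ∈ s, br ((x : ℂ) / v))) = -(br p / br ((z : ℂ) / x) *
        (t x * ((∏ v ∈ s, br (p * x / v)) / ∏ v ∈ s, br ((x : ℂ) / v)))) := by
      rw [e1, neg_mul, div_neg, mul_neg, mul_div_mul_comm]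
      ring
    have e3 : t z * (br (p * z / x) * (∏ v ∈ s, br (p * z / v)) /
        (br ((z : ℂ) / x) * ∏ v ∈ s, br ((z : ℂ) / v))) = br (p * z / x) / br ((z : ℂ) / x) *
        (t z * ((∏ v ∈ s, br (p * z / v)) / ∏ v ∈ s, br ((z : ℂ) / v))) := by
      rw [mul_div_mul_comm]
      ring
    rw [e2, e3]
    module

end Action

section Continuity
open Filter Topology

lemma br_continuousAt {α : Type*} [TopologicalSpace α] {f : α → ℂ} {a : α}
    (hf : ContinuousAt f a) (h : f a ≠ 0) : ContinuousAt (fun t => br (f t)) a :=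
  hf.sub (hf.inv₀ h)

lemma R12_continuousAt {α : Type*} [TopologicalSpace α] {q c : ℂ} (hq : q ≠ 0) {f : α → ℂ}
    {a : α} (hf : ContinuousAt f a) (h : f a ≠ 0) (s t : Fin 2 × Fin 3) :
    ContinuousAt (fun x => R12 q c (f x) s t) a := by
  have b0 := br_continuousAt hf h
  have b1 := br_continuousAt (continuousAt_const.mul hf) (mul_ne_zero hq h)
  have b2 := br_continuousAt (continuousAt_const.mul hf) (mul_ne_zero (pow_ne_zero 2 hq) h)
  simp only [R12, Matrix.of_apply]
  have hif : ∀ {P : Prop} [Decidable P] {g h : α → ℂ}, ContinuousAt g a → ContinuousAt h a →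
      ContinuousAt (fun x => if P then g x else h x) a := by
    intro P _ g h hg hh
    by_cases hP : P <;> simpa only [hP, if_true, if_false]
  exact hif b2 (hif b1 (hif b0 (hif b0 (hif b1 (hif b2 (hif continuousAt_const
    (hif continuousAt_const (hif continuousAt_const (hif continuousAt_const
      continuousAt_const)))))))))

lemma R12at_continuousAt {α : Type*} [TopologicalSpace α] {q c : ℂ} (hq : q ≠ 0) {N : ℕ}
    {f : α → ℂ} {a : α} (hf : ContinuousAt f a) (h : f a ≠ 0) (j : Fin N) :
    ContinuousAt (fun x => R12at q c (f x) j) a :=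
  continuousAt_pi.2 fun s => continuousAt_pi.2 fun t =>
    (R12_continuousAt hq hf h (s.1, s.2 j) (t.1, t.2 j)).mul continuousAt_const

lemma monodromy_continuousAt {α : Type*} [TopologicalSpace α] {q c : ℂ} (hq : q ≠ 0) {N : ℕ}
    {w : α → Fin N → ℂ} {z : α → ℂ} {a : α} (hw : ∀ j, ContinuousAt (fun t => w t j) a)
    (hz : ContinuousAt z a) (hw0 : ∀ j, w a j ≠ 0) (hz0 : z a ≠ 0)
    (s t : Fin 2 × (Fin N → Fin 3)) :
    ContinuousAt (fun x => monodromy q c (w x) (z x) s t) a := by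
  have h : ContinuousAt (fun x => monodromy q c (w x) (z x)) a := by
    unfold monodromy
    refine tendsto_list_prod _ fun j _ => ?_
    exact R12at_continuousAt hq ((continuousAt_const.mul hz).div (hw j) (hw0 j))
      (div_ne_zero (mul_ne_zero (inv_ne_zero hq) hz0) (hw0 j)) j
  exact continuousAt_pi.1 (continuousAt_pi.1 h s) t

lemma bethe_continuousAt {α : Type*} [TopologicalSpace α] {q c : ℂ} (hq : q ≠ 0) {N : ℕ}
    {w : α → Fin N → ℂ} {a : α} (hw : ∀ j, ContinuousAt (fun t => w t j) a)
    (hw0 : ∀ j, w a j ≠ 0) :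
    ContinuousAt (fun t => bethe q c (w t)) a := by
  unfold bethe
  have h : ContinuousAt
      (fun t => ((List.finRange N).map fun j => Bop q c (w t) (w t j)).prod) a := by
    refine tendsto_list_prod _ fun j _ => ?_
    change ContinuousAt (fun t => Bop q c (w t) (w t j)) a
    refine continuousAt_pi.2 fun σ => continuousAt_pi.2 fun τ => ?_
    exact monodromy_continuousAt hq hw (hw j) hw0 (hw0 j) (0, σ) (1, τ)
  refine continuousAt_pi.2 fun σ => ?_
  simp only [Matrix.mulVec, dotProduct]
  exact tendsto_finsetSum _ fun τ _ =>
    (continuousAt_pi.1 (continuousAt_pi.1 h σ) τ).mul continuousAt_const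

end Continuity

lemma sum_lagrange_br {S : Finset ℂˣ}
    (hS : ∀ u ∈ S, ∀ v ∈ S, u ≠ v → br ((u : ℂ) / v) ≠ 0) {n : ℕ} (hn : S.card = n + 1)
    {f : Polynomial ℂ} (hf : f.degree < S.card) {x : ℂ} (hx : x ≠ 0) :
    ∑ z ∈ S, f.eval ((z : ℂ) ^ 2) / (z : ℂ) ^ n *
      ((∏ v ∈ S.erase z, br (x / v)) / ∏ v ∈ S.erase z, br ((z : ℂ) / v)) =
      f.eval (x ^ 2) / x ^ n := by
  have hbr : ∀ {y : ℂ} (v : ℂˣ), y ≠ 0 → br (y / v) = (y ^ 2 - (v : ℂ) ^ 2) / (y * v) := by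
    intro y v hy
    have := v.ne_zero
    simp only [br]
    field_simp
  have hinj : Set.InjOn (fun u : ℂˣ => (u : ℂ) ^ 2) S := by
    intro u hu v hv huv
    by_contra h
    apply hS u hu v hv h
    simp only at huv
    rw [hbr v u.ne_zero, huv, sub_self, zero_div]
  have hf' := congrArg (Polynomial.eval (x ^ 2)) (Lagrange.eq_interpolate hinj hf)
  rw [Lagrange.interpolate_apply, Polynomial.eval_finsetSum] at hf'
  rw [hf', Finset.sum_div]
  refine Finset.sum_congr rfl fun z hz => ?_
  have hcard : (S.erase z).card = n := by rw [Finset.card_erase_of_mem hz, hn, Nat.add_sub_cancel]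
  rw [Polynomial.eval_mul, Polynomial.eval_C, Lagrange.basis, Polynomial.eval_prod,
    ← Finset.prod_div_distrib, mul_comm_div, mul_div_assoc]
  congr 1
  rw [← hcard, ← Finset.prod_const, ← Finset.prod_const, ← Finset.prod_div_distrib,
    ← Finset.prod_div_distrib]
  refine Finset.prod_congr rfl fun v hv => ?_
  have hzv : (z : ℂ) ^ 2 - (v : ℂ) ^ 2 ≠ 0 := fun h => (Finset.ne_of_mem_erase hv).symm
    (hinj hz (Finset.mem_of_mem_erase hv) (sub_eq_zero.1 h))
  have h1 := v.ne_zero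
  have h2 := z.ne_zero
  rw [hbr v hx, hbr v h2, Lagrange.basisDivisor, Polynomial.eval_mul, Polynomial.eval_C,
    Polynomial.eval_sub, Polynomial.eval_X, Polynomial.eval_C]
  field_simp

section Operators
variable {N : ℕ} {q c : ℂ} {w : Fin N → ℂ}

lemma commute_Bop (hq : q ≠ 0) (hq4 : q ^ 4 ≠ 1) (hc : c ^ 2 = br q * br (q ^ 2))
    (hw : ∀ j, w j ≠ 0) (x y : ℂˣ) :
    Commute ((fun z : ℂˣ => (Bop q c w z).mulVecLin) x)
      ((fun z : ℂˣ => (Bop q c w z).mulVecLin) y) := by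
  rw [commute_iff_eq, Module.End.mul_eq_comp, Module.End.mul_eq_comp]
  simp only
  rw [← Matrix.mulVecLin_mul, ← Matrix.mulVecLin_mul,
    Bop_comm hq hq4 hc hw x.ne_zero y.ne_zero]

/-- The off-shell Bethe vector `∏_{u ∈ s} ℬ(u) |∧⟩`. -/
def betheOn (hq : q ≠ 0) (hq4 : q ^ 4 ≠ 1) (hc : c ^ 2 = br q * br (q ^ 2))
    (hw : ∀ j, w j ≠ 0) (s : Finset ℂˣ) : (Fin N → Fin 3) → ℂ :=
  offShell (fun z : ℂˣ => (Bop q c w z).mulVecLin) (commute_Bop hq hq4 hc hw) (vac N) s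

lemma betheOn_insert (hq : q ≠ 0) (hq4 : q ^ 4 ≠ 1) (hc : c ^ 2 = br q * br (q ^ 2))
    (hw : ∀ j, w j ≠ 0) {x : ℂˣ} {s : Finset ℂˣ} (hx : x ∉ s) :
    betheOn hq hq4 hc hw (insert x s) = Bop q c w x *ᵥ betheOn hq hq4 hc hw s :=
  offShell_insert _ _ hx

lemma list_prod_Bop_mulVec_vac (hq : q ≠ 0) (hq4 : q ^ 4 ≠ 1) (hc : c ^ 2 = br q * br (q ^ 2))
    (hw : ∀ j, w j ≠ 0) {l : List ℂˣ} (hl : l.Nodup) :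
    (l.map fun u : ℂˣ => Bop q c w u).prod *ᵥ vac N =
      betheOn hq hq4 hc hw l.toFinset := by
  induction l with
  | nil => simp [betheOn, offShell_empty]
  | cons x l ih =>
    rw [List.nodup_cons] at hl
    rw [List.toFinset_cons, betheOn_insert hq hq4 hc hw (by simpa using hl.1), ← ih hl.2,
      List.map_cons, List.prod_cons, Matrix.mulVec_mulVec]

/-- The nonzero numbers `w j` as units. -/
def unitsOf (hw : ∀ j, w j ≠ 0) (j : Fin N) : ℂˣ := Units.mk0 (w j) (hw j)

lemma unitsOf_injective (hw : ∀ j, w j ≠ 0) (h1 : ∀ j k : Fin N, j ≠ k → w j ^ 2 ≠ w k ^ 2) :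
    Function.Injective (unitsOf hw) := by
  intro j k hjk
  by_contra h
  apply h1 j k h
  have := congrArg Units.val hjk
  simp only [unitsOf, Units.val_mk0] at this
  rw [this]

lemma bethe_eq_betheOn (hq : q ≠ 0) (hq4 : q ^ 4 ≠ 1) (hc : c ^ 2 = br q * br (q ^ 2))
    (hw : ∀ j, w j ≠ 0) (h1 : ∀ j k : Fin N, j ≠ k → w j ^ 2 ≠ w k ^ 2) :
    bethe q c w = betheOn hq hq4 hc hw (Finset.univ.image (unitsOf hw)) := by
  have := list_prod_Bop_mulVec_vac hq hq4 hc hw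
    ((List.nodup_finRange N).map (unitsOf_injective hw h1))
  rw [List.map_map] at this
  have e : ((List.finRange N).map (unitsOf hw)).toFinset = Finset.univ.image (unitsOf hw) := by
    ext; simp
  rw [← e, ← this]
  rfl

lemma Aop_mulVec_betheOn (hq : q ≠ 0) (hq4 : q ^ 4 ≠ 1) (hc : c ^ 2 = br q * br (q ^ 2))
    (hw : ∀ j, w j ≠ 0) (s : Finset ℂˣ) (z : ℂˣ) (hz : z ∉ s)
    (hs : ∀ u ∈ insert z s, ∀ v ∈ insert z s, u ≠ v → br ((u : ℂ) / v) ≠ 0) :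
    Aop q c w z *ᵥ betheOn hq hq4 hc hw s = ∑ u ∈ insert z s,
      ((∏ j, br (q * u / w j)) * ((∏ v ∈ s, br (q⁻¹ * u / v)) /
        ∏ v ∈ (insert z s).erase u, br ((u : ℂ) / v))) •
        betheOn hq hq4 hc hw ((insert z s).erase u) := by
  refine action_offShell (T := fun z : ℂˣ => (Aop q c w z).mulVecLin)
    (commute_Bop hq hq4 hc hw) (inv_ne_zero hq) ?_ ?_ s z hz hs
  · intro x y hxy e
    simp only [Matrix.mulVecLin_apply, Matrix.mulVec_mulVec,
      Aop_mul_Bop hq hc hw x.ne_zero y.ne_zero hxy, Matrix.sub_mulVec, Matrix.smul_mulVec]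
  · exact fun x => Aop_mulVec_vac hq _

lemma Dop_mulVec_betheOn (hq : q ≠ 0) (hq4 : q ^ 4 ≠ 1) (hc : c ^ 2 = br q * br (q ^ 2))
    (hw : ∀ j, w j ≠ 0) (s : Finset ℂˣ) (z : ℂˣ) (hz : z ∉ s)
    (hs : ∀ u ∈ insert z s, ∀ v ∈ insert z s, u ≠ v → br ((u : ℂ) / v) ≠ 0) :
    Dop q c w z *ᵥ betheOn hq hq4 hc hw s = ∑ u ∈ insert z s,
      ((∏ j, br (q⁻¹ * u / w j)) * ((∏ v ∈ s, br (q * u / v)) /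
        ∏ v ∈ (insert z s).erase u, br ((u : ℂ) / v))) •
        betheOn hq hq4 hc hw ((insert z s).erase u) := by
  refine action_offShell (T := fun z : ℂˣ => (Dop q c w z).mulVecLin)
    (commute_Bop hq hq4 hc hw) hq ?_ ?_ s z hz hs
  · intro x y hxy e
    simp only [Matrix.mulVecLin_apply, Matrix.mulVec_mulVec,
      Dop_mul_Bop hq hc hw x.ne_zero y.ne_zero hxy, Matrix.sub_mulVec, Matrix.smul_mulVec]
  · exact fun x => Dop_mulVec_vac hq _

lemma br_div_ne_zero {x y : ℂ} (hx : x ≠ 0) (hy : y ≠ 0) (h : x ^ 2 ≠ y ^ 2) :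
    br (x / y) ≠ 0 :=
  br_ne_zero (div_ne_zero hx hy) fun h' => h (by
    rwa [div_pow, div_eq_one_iff_eq (pow_ne_zero 2 hy)] at h')

lemma Aop_mulVec_bethe (hq : q ≠ 0) (hq4 : q ^ 4 ≠ 1) (hc : c ^ 2 = br q * br (q ^ 2))
    (hw : ∀ j, w j ≠ 0) (h1 : ∀ j k : Fin N, j ≠ k → w j ^ 2 ≠ w k ^ 2) {z : ℂ} (hz : z ≠ 0) :
    Aop q c w z *ᵥ bethe q c w = Dop q c w z *ᵥ bethe q c w := by
  have hinj := unitsOf_injective hw h1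
  have generic : ∀ z : ℂ, z ≠ 0 → (∀ j, z ^ 2 ≠ w j ^ 2) →
      Aop q c w z *ᵥ bethe q c w = Dop q c w z *ᵥ bethe q c w := by
    intro z hz hzw
    have hz' : Units.mk0 z hz ∉ Finset.univ.image (unitsOf hw) := by
      simp only [Finset.mem_image, Finset.mem_univ, true_and, not_exists]
      intro j hj
      apply hzw j
      have := congrArg Units.val hj
      simp only [unitsOf, Units.val_mk0] at this
      rw [this]
    have hs : ∀ u ∈ insert (Units.mk0 z hz) (Finset.univ.image (unitsOf hw)),
        ∀ v ∈ insert (Units.mk0 z hz) (Finset.univ.image (unitsOf hw)), u ≠ v →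
        br ((u : ℂ) / v) ≠ 0 := by
      intro u hu v hv huv
      refine br_div_ne_zero u.ne_zero v.ne_zero ?_
      simp only [Finset.mem_insert, Finset.mem_image, Finset.mem_univ, true_and] at hu hv
      rcases hu with rfl | ⟨j, rfl⟩ <;> rcases hv with rfl | ⟨k, rfl⟩
      · exact absurd rfl huv
      · exact hzw k
      · exact (hzw j).symm
      · exact h1 j k fun h => huv (h ▸ rfl)
    have hA := Aop_mulVec_betheOn hq hq4 hc hw _ _ hz' hs
    have hD := Dop_mulVec_betheOn hq hq4 hc hw _ _ hz' hs
    rw [Units.val_mk0, ← bethe_eq_betheOn hq hq4 hc hw h1] at hA hD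
    rw [hA, hD]
    refine Finset.sum_congr rfl fun u _ => ?_
    rw [Finset.prod_image fun j _ k _ h => hinj h, Finset.prod_image fun j _ k _ h => hinj h]
    simp only [unitsOf, Units.val_mk0]
    congr 1
    ring
  have hcont : ∀ a b : Fin 2, ContinuousAt (fun z => (Matrix.of fun σ τ =>
      monodromy q c w z (a, σ) (b, τ) : Matrix (Fin N → Fin 3) (Fin N → Fin 3) ℂ) *ᵥ
        bethe q c w) z := by
    intro a b
    refine continuousAt_pi.2 fun σ => ?_
    simp only [Matrix.mulVec, dotProduct]
    exact tendsto_finsetSum _ fun τ _ => (monodromy_continuousAt hq (w := fun _ => w) (z := id)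
      (fun j => continuousAt_const) continuousAt_id hw hz (a, σ) (b, τ)).mul continuousAt_const
  have hfin : {z : ℂ | ∃ j, z ^ 2 = w j ^ 2}.Finite := by
    have : {z : ℂ | ∃ j, z ^ 2 = w j ^ 2} ⊆ ⋃ j, {w j, -w j} := by
      rintro z ⟨j, hj⟩
      exact Set.mem_iUnion.2 ⟨j, by simpa using sq_eq_sq_iff_eq_or_eq_neg.1 hj⟩
    exact (Set.finite_iUnion fun j => Set.toFinite _).subset this
  have hev : ∀ᶠ x in nhdsWithin z {z}ᶜ, Aop q c w x *ᵥ bethe q c w = Dop q c w x *ᵥ bethe q c w := by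
    have e1 : ∀ᶠ x in nhdsWithin z {z}ᶜ, x ≠ 0 :=
      (continuousAt_id.eventually_ne hz).filter_mono nhdsWithin_le_nhds
    have e2 : ∀ᶠ x in nhdsWithin z {z}ᶜ, x ∉ {z : ℂ | ∃ j, z ^ 2 = w j ^ 2} :=
      hfin.eventually_cofinite_notMem.filter_mono (nhdsNE_le_cofinite z)
    filter_upwards [e1, e2] with x hx1 hx2
    exact generic x hx1 fun j hj => hx2 ⟨j, hj⟩
  exact tendsto_nhds_unique_of_eventuallyEq ((hcont 0 0).mono_left nhdsWithin_le_nhds)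
    ((hcont 1 1).mono_left nhdsWithin_le_nhds) hev

lemma bethe_inv_dotProduct_Aop (hq : q ≠ 0) (hq4 : q ^ 4 ≠ 1) (hc : c ^ 2 = br q * br (q ^ 2))
    (hw : ∀ j, w j ≠ 0) (h1 : ∀ j k : Fin N, j ≠ k → w j ^ 2 ≠ w k ^ 2) {z : ℂ} (hz : z ≠ 0)
    (v : (Fin N → Fin 3) → ℂ) :
    bethe q c (fun j => (w j)⁻¹) ⬝ᵥ Aop q c w z *ᵥ v =
      bethe q c (fun j => (w j)⁻¹) ⬝ᵥ Dop q c w z *ᵥ v := by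
  have h := Aop_mulVec_bethe (w := fun j => (w j)⁻¹) hq hq4 hc (fun j => inv_ne_zero (hw j))
    (fun j k hjk => by simpa only [inv_pow, ne_eq, _root_.inv_inj] using h1 j k hjk)
    (inv_ne_zero hz)
  rw [Aop_inv hq, Dop_inv hq, Matrix.smul_mulVec, Matrix.smul_mulVec] at h
  have h' := smul_right_injective _ (pow_ne_zero N (neg_ne_zero.2 one_ne_zero)) h
  rw [Matrix.dotProduct_mulVec, Matrix.dotProduct_mulVec, ← Matrix.mulVec_transpose,
    ← Matrix.mulVec_transpose, h']

end Operators

section Functional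
variable {N : ℕ} {q c : ℂ} {w : Fin N → ℂ}

/-- The product `∏_{l ≠ i} [q u / w_l] [q⁻¹ u / w_l]`. -/
def pOff (q : ℂ) (w : Fin N → ℂ) (i : Fin N) (u : ℂ) : ℂ :=
  ∏ l ∈ Finset.univ.erase i, br (q * u / w l) * br (q⁻¹ * u / w l)

/-- The pairing of the off-shell Bethe vector with the Bethe vector at inverse
inhomogeneities. -/
def pairing (hq : q ≠ 0) (hq4 : q ^ 4 ≠ 1) (hc : c ^ 2 = br q * br (q ^ 2))
    (hw : ∀ j, w j ≠ 0) (s : Finset ℂˣ) : ℂ :=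
  bethe q c (fun j => (w j)⁻¹) ⬝ᵥ betheOn hq hq4 hc hw s

lemma sum_mul_prod_br (hw : ∀ j, w j ≠ 0) {S : Finset ℂˣ}
    (hS : ∀ u ∈ S, ∀ v ∈ S, u ≠ v → br ((u : ℂ) / v) ≠ 0) (hn : S.card = N + 1) (i : Fin N)
    {x : ℂ} (hx : x ≠ 0) :
    ∑ z ∈ S, ((z : ℂ) * ∏ l ∈ Finset.univ.erase i, br ((z : ℂ) / w l)) *
      ((∏ v ∈ S.erase z, br (x / v)) / ∏ v ∈ S.erase z, br ((z : ℂ) / v)) =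
      x * ∏ l ∈ Finset.univ.erase i, br (x / w l) := by
  set f : Polynomial ℂ := Polynomial.X * ∏ l ∈ Finset.univ.erase i,
    (Polynomial.C (w l)⁻¹ * (Polynomial.X - Polynomial.C (w l ^ 2))) with hf
  have hcard : (Finset.univ.erase i : Finset (Fin N)).card + 1 = N := by
    rw [Finset.card_erase_add_one (Finset.mem_univ i), Finset.card_fin]
  have hdeg : f.degree < S.card := by
    have h1 : f.degree = 1 + ∑ _l ∈ Finset.univ.erase i, (1 : WithBot ℕ) := by
      rw [hf, Polynomial.degree_mul, Polynomial.degree_X, Polynomial.degree_prod]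
      congr 1
      refine Finset.sum_congr rfl fun l _ => ?_
      rw [Polynomial.degree_C_mul (inv_ne_zero (hw l)), Polynomial.degree_X_sub_C]
    rw [h1, hn, Finset.sum_const, nsmul_one, add_comm]
    norm_cast
    omega
  have heval : ∀ y : ℂ, y ≠ 0 → f.eval (y ^ 2) / y ^ N =
      y * ∏ l ∈ Finset.univ.erase i, br (y / w l) := by
    intro y hy
    have e : y ^ N = y * ∏ _l ∈ Finset.univ.erase i, y := by
      rw [Finset.prod_const, ← pow_succ', hcard]
    rw [hf, Polynomial.eval_mul, Polynomial.eval_X, Polynomial.eval_prod, e, sq, mul_assoc,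
      mul_div_mul_left _ _ hy, mul_div_assoc, ← Finset.prod_div_distrib]
    congr 1
    refine Finset.prod_congr rfl fun l _ => ?_
    have := hw l
    rw [Polynomial.eval_mul, Polynomial.eval_sub, Polynomial.eval_X, Polynomial.eval_C,
      Polynomial.eval_C, br]
    field_simp
  have h := sum_lagrange_br hS hn hdeg hx
  rw [heval x hx] at h
  rw [← h]
  exact Finset.sum_congr rfl fun z _ => by rw [heval z z.ne_zero]

lemma sum_pOff_mul_pairing (hq : q ≠ 0) (hq4 : q ^ 4 ≠ 1) (hc : c ^ 2 = br q * br (q ^ 2))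
    (hw : ∀ j, w j ≠ 0) (h1 : ∀ j k : Fin N, j ≠ k → w j ^ 2 ≠ w k ^ 2) {S : Finset ℂˣ}
    (hS : ∀ u ∈ S, ∀ v ∈ S, u ≠ v → br ((u : ℂ) / v) ≠ 0) (hn : S.card = N + 1) (i : Fin N) :
    ∑ u ∈ S, pOff q w i u * (pairing hq hq4 hc hw (S.erase u) /
      ∏ v ∈ S.erase u, br ((u : ℂ) / v)) = 0 := by
  set a : ℂˣ → ℂ := fun u => ∏ j, br (q * u / w j) with ha
  set d : ℂˣ → ℂ := fun u => ∏ j, br (q⁻¹ * u / w j) with hd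
  set X : ℂˣ → ℂ := fun u => pairing hq hq4 hc hw (S.erase u) /
      ∏ v ∈ S.erase u, br ((u : ℂ) / v) with hX
  set h : ℂ → ℂ := fun x => x * ∏ l ∈ Finset.univ.erase i, br (x / w l) with hh
  have row : ∀ z ∈ S, ∑ u ∈ S, (a u * (∏ v ∈ S.erase z, br (q⁻¹ * u / v)) -
      d u * ∏ v ∈ S.erase z, br (q * u / v)) * X u = 0 := by
    intro z hz
    have hS' : ∀ u ∈ insert z (S.erase z), ∀ v ∈ insert z (S.erase z), u ≠ v →
        br ((u : ℂ) / v) ≠ 0 := by rwa [Finset.insert_erase hz]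
    have hA := Aop_mulVec_betheOn hq hq4 hc hw _ z (Finset.notMem_erase z S) hS'
    have hD := Dop_mulVec_betheOn hq hq4 hc hw _ z (Finset.notMem_erase z S) hS'
    have hAD := bethe_inv_dotProduct_Aop hq hq4 hc hw h1 z.ne_zero
      (betheOn hq hq4 hc hw (S.erase z))
    rw [hA, hD, Finset.insert_erase hz, dotProduct_sum, dotProduct_sum, ← sub_eq_zero,
      ← Finset.sum_sub_distrib] at hAD
    rw [← hAD]
    refine Finset.sum_congr rfl fun u _ => ?_
    rw [dotProduct_smul, dotProduct_smul, smul_eq_mul, smul_eq_mul]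
    simp only [hX, pairing]
    ring
  have key : ∑ u ∈ S, (a u * h (q⁻¹ * u) - d u * h (q * u)) * X u = 0 := by
    have hL := fun (x : ℂ) (hx : x ≠ 0) => sum_mul_prod_br hw hS hn i hx
    calc ∑ u ∈ S, (a u * h (q⁻¹ * u) - d u * h (q * u)) * X u
        = ∑ z ∈ S, h z / (∏ v ∈ S.erase z, br ((z : ℂ) / v)) *
          ∑ u ∈ S, (a u * (∏ v ∈ S.erase z, br (q⁻¹ * u / v)) -
            d u * ∏ v ∈ S.erase z, br (q * u / v)) * X u := by
          simp only [Finset.mul_sum]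
          rw [Finset.sum_comm]
          refine Finset.sum_congr rfl fun u _ => ?_
          rw [hh]
          simp only
          rw [← hL _ (mul_ne_zero (inv_ne_zero hq) u.ne_zero),
            ← hL _ (mul_ne_zero hq u.ne_zero), Finset.mul_sum, Finset.mul_sum,
            ← Finset.sum_sub_distrib, Finset.sum_mul]
          exact Finset.sum_congr rfl fun z _ => by ring
      _ = 0 := Finset.sum_eq_zero fun z hz => by rw [row z hz, mul_zero]
  have hcoef : ∀ u : ℂˣ, a u * h (q⁻¹ * u) - d u * h (q * u) =
      br (q ^ 2) * w i * pOff q w i u := by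
    intro u
    have hu := u.ne_zero
    have hi := hw i
    simp only [ha, hd, hh, pOff, Finset.prod_mul_distrib]
    rw [← Finset.mul_prod_erase _ _ (Finset.mem_univ i),
      ← Finset.mul_prod_erase Finset.univ (fun j => br (q⁻¹ * u / w j)) (Finset.mem_univ i)]
    have e : br (q * u / w i) * (q⁻¹ * u) - br (q⁻¹ * u / w i) * (q * u) =
        br (q ^ 2) * w i := by
      simp only [br]
      field_simp
      ring
    rw [← e]
    ring
  have h0 : br (q ^ 2) * w i ≠ 0 := by
    refine mul_ne_zero (br_ne_zero (pow_ne_zero 2 hq) ?_) (hw i)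
    rwa [← pow_mul]
  apply mul_left_cancel₀ h0
  rw [mul_zero, Finset.mul_sum, ← key]
  refine Finset.sum_congr rfl fun u _ => ?_
  rw [hcoef, mul_assoc]
  simp only [hX, mul_assoc]

end Functional

lemma sum_mul_det_updateCol_single {n : Type*} [Fintype n] [DecidableEq n] (M : Matrix n n ℂ)
    (i : n) (a : ℂ) :
    ∑ k, M i k * (M.updateCol k (Pi.single i a)).det = a * M.det := by
  have h := congrFun (congrFun (Matrix.mul_adjugate M) i) i
  rw [Matrix.mul_apply, Matrix.smul_apply, Matrix.one_apply_eq, smul_eq_mul, mul_one] at h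
  rw [← h, Finset.mul_sum]
  refine Finset.sum_congr rfl fun k _ => ?_
  rw [← Matrix.cramer_apply, Matrix.cramer_eq_adjugate_mulVec, Matrix.mulVec, dotProduct_single]
  ring

/-- A function of `N` points satisfying the exchange relations is determined, up to a determinant,
by its value at the points `y`. -/
lemma prod_mul_eq_det_mul {n α : Type*} [Fintype n] [DecidableEq n] (G : Set α)
    (p : n → α → ℂ) (y : n → α) (F : (n → α) → ℂ) (hyG : ∀ i, y i ∈ G)
    (hp : ∀ i l, i ≠ l → p i (y l) = 0) (hp0 : ∀ i, p i (y i) ≠ 0)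
    (hperm : ∀ σ : Equiv.Perm n, F (y ∘ σ) = (Equiv.Perm.sign σ : ℤ) * F y)
    (hrel : ∀ v : n → α, Function.Injective v → (∀ k, v k ∈ G) → ∀ i, y i ∉ Set.range v →
      p i (y i) * F v = ∑ k, p i (v k) * F (Function.update v k (y i)))
    (v : n → α) (hv : Function.Injective v) (hvG : ∀ k, v k ∈ G) :
    (∏ i, p i (y i)) * F v = (Matrix.of fun i k => p i (v k)).det * F y := by
  classical
  induction hm : (Finset.univ.filter fun i => y i ∉ Set.range v).card generalizing v with
  | zero =>
    have hr : ∀ i, ∃ k, v k = y i := by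
      intro i
      by_contra h
      have : i ∈ Finset.univ.filter fun i => y i ∉ Set.range v := by simpa using h
      rw [Finset.card_eq_zero.1 hm] at this
      exact absurd this (Finset.notMem_empty i)
    choose τ hτ using hr
    have hy : Function.Injective y := by
      intro i l h
      by_contra hil
      exact hp0 l (by rw [← h]; exact hp l i (Ne.symm hil))
    have hτinj : Function.Injective τ := fun i l h => hy (by rw [← hτ, ← hτ, h])
    set σ : Equiv.Perm n := (Equiv.ofBijective τ (Finite.injective_iff_bijective.1 hτinj)).symm
    have hvσ : v = y ∘ σ := by
      funext k
      rw [Function.comp_apply, ← hτ]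
      congr 1
      exact ((Equiv.ofBijective τ (Finite.injective_iff_bijective.1 hτinj)).apply_symm_apply k).symm
    have hdiag : (Matrix.of fun i k => p i (y k)) = Matrix.diagonal fun i => p i (y i) := by
      ext i k
      by_cases h : i = k
      · subst h; simp
      · rw [Matrix.diagonal_apply_ne _ h, Matrix.of_apply, hp i k h]
    have hdet := Matrix.det_permute' σ (Matrix.of fun i k => p i (y k))
    have e : (Matrix.of fun i k => p i (v k)) =
        (Matrix.of fun i k => p i (y k)).submatrix id σ := by
      ext i k
      simp [hvσ]
    rw [e, hdet, hdiag, Matrix.det_diagonal, hvσ, hperm]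
    ring
  | succ m ih =>
    have hne : (Finset.univ.filter fun i => y i ∉ Set.range v).Nonempty := by
      rw [← Finset.card_pos, hm]; exact Nat.succ_pos m
    obtain ⟨i, hi⟩ := hne
    have hi' : y i ∉ Set.range v := by simpa using hi
    apply mul_left_cancel₀ (hp0 i)
    have hterm : ∀ k, p i (v k) * ((∏ j, p j (y j)) * F (Function.update v k (y i))) =
        p i (v k) * (((Matrix.of fun i k => p i (v k)).updateCol k
          (Pi.single i (p i (y i)))).det * F y) := by
      intro k
      by_cases h0 : p i (v k) = 0
      · rw [h0, zero_mul, zero_mul]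
      congr 1
      have hk : ∀ l, l ≠ i → v k ≠ y l := fun l hl h => h0 (by rw [h]; exact hp i l hl.symm)
      have hinj : Function.Injective (Function.update v k (y i)) := by
        intro a b hab
        by_cases ha : a = k <;> by_cases hb : b = k
        · rw [ha, hb]
        · subst ha
          rw [Function.update_self, Function.update_of_ne hb] at hab
          exact absurd ⟨b, hab.symm⟩ hi'
        · subst hb
          rw [Function.update_self, Function.update_of_ne ha] at hab
          exact absurd ⟨a, hab⟩ hi'
        · rw [Function.update_of_ne ha, Function.update_of_ne hb] at hab
          exact hv hab
      have hG' : ∀ b, Function.update v k (y i) b ∈ G := by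
        intro b
        by_cases hb : b = k
        · subst hb; rw [Function.update_self]; exact hyG i
        · rw [Function.update_of_ne hb]; exact hvG b
      have hset : (Finset.univ.filter fun l => y l ∉ Set.range (Function.update v k (y i))) =
          (Finset.univ.filter fun l => y l ∉ Set.range v).erase i := by
        ext l
        simp only [Finset.mem_filter, Finset.mem_univ, true_and, Finset.mem_erase, Set.mem_range,
          not_exists]
        constructor
        · intro h
          refine ⟨fun hl => h k (by rw [hl, Function.update_self]), fun b hb => ?_⟩
          by_cases hbk : b = k
          · subst hbk
            exact hk l (fun hl => h b (by rw [hl, Function.update_self])) hb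
          · exact h b (by rw [Function.update_of_ne hbk, hb])
        · rintro ⟨hl, h⟩ b hb
          by_cases hbk : b = k
          · subst hbk
            rw [Function.update_self] at hb
            exact hp0 l (by rw [← hb]; exact hp l i hl)
          · rw [Function.update_of_ne hbk] at hb
            exact h b hb
      rw [ih _ hinj hG' (by rw [hset, Finset.card_erase_of_mem hi, hm, Nat.add_sub_cancel])]
      congr 2
      ext a b
      by_cases hb : b = k
      · subst hb
        rw [Matrix.updateCol_self, Matrix.of_apply, Function.update_self]
        by_cases ha : a = i
        · subst ha; rw [Pi.single_eq_same]
        · rw [Pi.single_eq_of_ne ha, hp a i ha]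
      · rw [Matrix.updateCol_ne hb, Matrix.of_apply, Matrix.of_apply, Function.update_of_ne hb]
    calc p i (y i) * ((∏ j, p j (y j)) * F v)
        = ∑ k, p i (v k) * ((∏ j, p j (y j)) * F (Function.update v k (y i))) := by
          rw [mul_left_comm, hrel v hv hvG i hi', Finset.mul_sum]
          exact Finset.sum_congr rfl fun k _ => by ring
      _ = (∑ k, (Matrix.of fun i k => p i (v k)) i k * ((Matrix.of fun i k => p i (v k)).updateCol k
          (Pi.single i (p i (y i)))).det) * F y := by
          rw [Finset.sum_mul]
          exact Finset.sum_congr rfl fun k _ => by rw [hterm, Matrix.of_apply, mul_assoc]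
      _ = p i (y i) * ((Matrix.of fun i k => p i (v k)).det * F y) := by
          rw [sum_mul_det_updateCol_single, mul_assoc]

/-- The determinant `det (v_k^{2m - N + 1})`. -/
def symVandermonde {N : ℕ} (v : Fin N → ℂˣ) : ℂ :=
  (Matrix.of fun k m : Fin N => ((v k : ℂ) ^ 2) ^ (m : ℕ) / (v k : ℂ) ^ (N - 1)).det

lemma symVandermonde_comp_perm {N : ℕ} (v : Fin N → ℂˣ) (σ : Equiv.Perm (Fin N)) :
    symVandermonde (v ∘ σ) = (Equiv.Perm.sign σ : ℤ) * symVandermonde v := by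
  rw [symVandermonde, symVandermonde, ← Matrix.det_permute]
  rfl

lemma symVandermonde_eq {N : ℕ} (v : Fin N → ℂˣ) :
    symVandermonde v = (∏ k, ((v k : ℂ) ^ (N - 1))⁻¹) *
      (Matrix.vandermonde fun k => (v k : ℂ) ^ 2).det := by
  rw [← Matrix.det_mul_column, symVandermonde]
  congr 1
  ext k m
  rw [Matrix.of_apply, Matrix.of_apply, Matrix.vandermonde_apply, div_eq_inv_mul]

lemma symVandermonde_ne_zero {N : ℕ} {v : Fin N → ℂˣ}
    (hv : Function.Injective fun k => (v k : ℂ) ^ 2) : symVandermonde v ≠ 0 := by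
  rw [symVandermonde_eq]
  refine mul_ne_zero (Finset.prod_ne_zero_iff.2 fun k _ => ?_)
    (Matrix.det_vandermonde_ne_zero_iff.2 hv)
  exact inv_ne_zero (pow_ne_zero _ (v k).ne_zero)

lemma symVandermonde_smul {N : ℕ} (a : ℂˣ) (v : Fin N → ℂˣ) :
    symVandermonde (fun k => a * v k) = symVandermonde v := by
  have h : symVandermonde (fun k => a * v k) =
      (∏ m : Fin N, ((a : ℂ) ^ 2) ^ (m : ℕ) / (a : ℂ) ^ (N - 1)) * symVandermonde v := by
    rw [symVandermonde, symVandermonde, ← Matrix.det_mul_row]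
    congr 1
    ext k m
    simp only [Matrix.of_apply, Units.val_mul]
    rw [mul_pow, mul_pow, mul_pow, mul_div_mul_comm]
  have h1 : (∏ m : Fin N, ((a : ℂ) ^ 2) ^ (m : ℕ) / (a : ℂ) ^ (N - 1)) = 1 := by
    rw [Finset.prod_div_distrib, Finset.prod_const, Finset.card_fin, Finset.prod_pow_eq_pow_sum,
      Fin.sum_univ_eq_sum_range (fun m => m) N, ← pow_mul, ← pow_mul, mul_comm 2,
      Finset.sum_range_id_mul_two, mul_comm N]
    exact div_self (pow_ne_zero _ a.ne_zero)
  rw [h, h1, one_mul]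

lemma symVandermonde_update {N : ℕ} {v : Fin N → ℂˣ} (hv : Function.Injective v)
    (hv' : ∀ k l, v k ≠ v l → br ((v k : ℂ) / v l) ≠ 0) (k : Fin N) (y : ℂˣ) :
    symVandermonde (Function.update v k y) =
      ((∏ l ∈ Finset.univ.erase k, br ((y : ℂ) / v l)) /
        ∏ l ∈ Finset.univ.erase k, br ((v k : ℂ) / v l)) * symVandermonde v := by
  have hN : N - 1 + 1 = N := Nat.sub_add_cancel (Fin.pos k)
  set M : Matrix (Fin N) (Fin N) ℂ :=
    Matrix.of fun k m : Fin N => ((v k : ℂ) ^ 2) ^ (m : ℕ) / (v k : ℂ) ^ (N - 1) with hM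
  set L : Fin N → ℂ := fun j => (∏ l ∈ Finset.univ.erase j, br ((y : ℂ) / v l)) /
        ∏ l ∈ Finset.univ.erase j, br ((v j : ℂ) / v l) with hL
  have e : (Matrix.of fun k' m : Fin N => ((Function.update v k y k' : ℂ) ^ 2) ^ (m : ℕ) /
      (Function.update v k y k' : ℂ) ^ (N - 1)) = M.updateRow k (∑ j, L j • M j) := by
    ext a m
    by_cases ha : a = k
    · subst ha
      rw [Matrix.updateRow_self, Matrix.of_apply, Function.update_self, Finset.sum_apply]
      have hcard : (Finset.univ.image v).card = N - 1 + 1 := by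
        rw [Finset.card_image_of_injective _ hv, Finset.card_fin, hN]
      have h := sum_lagrange_br (S := Finset.univ.image v) ?_ hcard
        (f := (Polynomial.X : Polynomial ℂ) ^ (m : ℕ)) ?_ y.ne_zero
      · rw [Polynomial.eval_pow, Polynomial.eval_X] at h
        rw [← h, Finset.sum_image fun j _ l _ hjl => hv hjl]
        refine Finset.sum_congr rfl fun j _ => ?_
        rw [← Finset.image_erase hv, Finset.prod_image fun j _ l _ hjl => hv hjl,
          Finset.prod_image fun j _ l _ hjl => hv hjl, Polynomial.eval_pow, Polynomial.eval_X,
          Pi.smul_apply, smul_eq_mul, mul_comm]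
        rfl
      · simp only [Finset.mem_image, Finset.mem_univ, true_and]
        rintro _ ⟨j, rfl⟩ _ ⟨l, rfl⟩ hjl
        exact hv' j l hjl
      · rw [Polynomial.degree_X_pow, Finset.card_image_of_injective _ hv, Finset.card_fin]
        exact_mod_cast m.2
    · rw [Matrix.updateRow_ne ha, Matrix.of_apply, Function.update_of_ne ha]
      rfl
  rw [symVandermonde, e, Matrix.det_updateRow_sum, smul_eq_mul]
  rfl

section Evaluation
variable {N : ℕ} {q c : ℂ} {w : Fin N → ℂ}

lemma pairing_exchange (hq : q ≠ 0) (hq4 : q ^ 4 ≠ 1) (hc : c ^ 2 = br q * br (q ^ 2))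
    (hw : ∀ j, w j ≠ 0) (h1 : ∀ j k : Fin N, j ≠ k → w j ^ 2 ≠ w k ^ 2) {v : Fin N → ℂˣ}
    (hv : Function.Injective v) {y : ℂˣ} (hy : y ∉ Set.range v)
    (hvv : ∀ k l, v k ≠ v l → br ((v k : ℂ) / v l) ≠ 0)
    (hyv : ∀ k, br ((y : ℂ) / v k) ≠ 0) (i : Fin N) :
    pOff q w i y * (pairing hq hq4 hc hw (Finset.univ.image v) * symVandermonde v) =
      ∑ k, pOff q w i (v k) *
        (pairing hq hq4 hc hw (Finset.univ.image (Function.update v k y)) *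
          symVandermonde (Function.update v k y)) := by
  have hy' : y ∉ Finset.univ.image v := by simpa using hy
  have hvy : ∀ k, br ((v k : ℂ) / y) = -br ((y : ℂ) / v k) := fun k => by rw [← br_inv, inv_div]
  have hcard : (insert y (Finset.univ.image v)).card = N + 1 := by
    rw [Finset.card_insert_of_notMem hy', Finset.card_image_of_injective _ hv, Finset.card_fin]
  have h := sum_pOff_mul_pairing hq hq4 hc hw h1 (S := insert y (Finset.univ.image v)) ?_ hcard i
  · rw [Finset.sum_insert hy', Finset.erase_insert hy', Finset.sum_image fun _ _ _ _ e => hv e,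
      Finset.prod_image fun _ _ _ _ e => hv e] at h
    have h0 : ∏ k, br ((y : ℂ) / v k) ≠ 0 := Finset.prod_ne_zero_iff.2 fun k _ => hyv k
    have h' : pOff q w i y * pairing hq hq4 hc hw (Finset.univ.image v) =
        -(∏ k, br ((y : ℂ) / v k)) * ∑ k, pOff q w i (v k) *
          (pairing hq hq4 hc hw ((insert y (Finset.univ.image v)).erase (v k)) /
            ∏ u ∈ (insert y (Finset.univ.image v)).erase (v k), br ((v k : ℂ) / u)) := by
      rw [eq_neg_of_add_eq_zero_right h]
      field_simp
    rw [← mul_assoc, h', mul_assoc, Finset.sum_mul, Finset.mul_sum]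
    refine Finset.sum_congr rfl fun k _ => ?_
    have hky : y ≠ v k := fun e => hy ⟨k, e.symm⟩
    have himg : Finset.univ.image (Function.update v k y) =
        (insert y (Finset.univ.image v)).erase (v k) := by
      rw [Finset.erase_insert_of_ne hky, ← Finset.image_erase hv]
      ext u
      simp only [Finset.mem_image, Finset.mem_univ, true_and, Finset.mem_insert,
        Finset.mem_erase, and_true]
      constructor
      · rintro ⟨a, rfl⟩
        by_cases ha : a = k
        · subst ha; exact Or.inl (Function.update_self ..)
        · exact Or.inr ⟨a, ha, (Function.update_of_ne ha ..).symm⟩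
      · rintro (rfl | ⟨a, ha, rfl⟩)
        · exact ⟨k, Function.update_self ..⟩
        · exact ⟨a, Function.update_of_ne ha ..⟩
    have hprod : ∏ u ∈ (insert y (Finset.univ.image v)).erase (v k), br ((v k : ℂ) / u) =
        -br ((y : ℂ) / v k) * ∏ l ∈ Finset.univ.erase k, br ((v k : ℂ) / v l) := by
      rw [Finset.erase_insert_of_ne hky, Finset.prod_insert
        (fun e => hy' (Finset.mem_of_mem_erase e)), ← Finset.image_erase hv,
        Finset.prod_image fun _ _ _ _ e => hv e, hvy]
    have hk0 : ∏ l ∈ Finset.univ.erase k, br ((v k : ℂ) / v l) ≠ 0 :=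
      Finset.prod_ne_zero_iff.2 fun l hl => hvv k l fun e => Finset.ne_of_mem_erase hl (hv e).symm
    rw [himg, hprod, symVandermonde_update hv hvv,
      ← Finset.mul_prod_erase _ _ (Finset.mem_univ k)]
    have := hyv k
    field_simp
  · intro u hu u' hu' huu
    simp only [Finset.mem_insert, Finset.mem_image, Finset.mem_univ, true_and] at hu hu'
    rcases hu with rfl | ⟨k, rfl⟩ <;> rcases hu' with rfl | ⟨l, rfl⟩
    · exact absurd rfl huu
    · exact hyv l
    · rw [hvy]; exact neg_ne_zero.2 (hyv k)
    · exact hvv k l huu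

lemma Dop_mulVec_betheOn_eq_zero (hq : q ≠ 0) (hq4 : q ^ 4 ≠ 1)
    (hc : c ^ 2 = br q * br (q ^ 2)) (hw : ∀ j, w j ≠ 0) (s : Finset ℂˣ) (z : ℂˣ) (hz : z ∉ s)
    (hs : ∀ u ∈ insert z s, ∀ v ∈ insert z s, u ≠ v → br ((u : ℂ) / v) ≠ 0)
    (hd : ∀ u ∈ s, ∏ j, br (q⁻¹ * u / w j) = 0)
    (hdz : (∏ j, br (q⁻¹ * z / w j)) * ∏ v ∈ s, br (q * z / v) = 0) :
    Dop q c w z *ᵥ betheOn hq hq4 hc hw s = 0 := by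
  rw [Dop_mulVec_betheOn hq hq4 hc hw s z hz hs, Finset.sum_insert hz, ← mul_div_assoc, hdz,
    zero_div, zero_smul, zero_add]
  exact Finset.sum_eq_zero fun u hu => by rw [hd u hu, zero_mul, zero_smul]

lemma Cop_mulVec_betheOn (hq : q ≠ 0) (hq4 : q ^ 4 ≠ 1) (hc : c ^ 2 = br q * br (q ^ 2))
    (hw : ∀ j, w j ≠ 0) {z z' : ℂˣ} (hzz : (z' : ℂ) = q * z) (s : Finset ℂˣ) (hz' : z' ∉ s)
    (hz : z ∉ insert z' s)
    (hs : ∀ u ∈ insert z (insert z' s), ∀ v ∈ insert z (insert z' s), u ≠ v →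
      br ((u : ℂ) / v) ≠ 0)
    (hd : ∀ u ∈ insert z' s, ∏ j, br (q⁻¹ * u / w j) = 0) :
    Cop q c w z *ᵥ betheOn hq hq4 hc hw (insert z' s) =
      -((∏ j, br (q * z' / w j)) * ∏ j, br (q⁻¹ * z / w j)) • betheOn hq hq4 hc hw s := by
  have hbq : br q ≠ 0 := br_ne_zero hq fun h => hq4 (by
    rw [show 4 = 2 * 2 from rfl, pow_mul, h, one_pow])
  induction s using Finset.induction_on with
  | empty =>
    have hne : br ((z : ℂ) / z') ≠ 0 := hs z (by simp) z' (by simp) (by simpa using hz)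
    have e : br ((z : ℂ) / z') = -br q := by
      rw [← br_inv, hzz]
      congr 1
      have := z.ne_zero
      field_simp
    have e0 : betheOn hq hq4 hc hw ∅ = vac N := offShell_empty ..
    rw [betheOn_insert hq hq4 hc hw hz', e0, Matrix.mulVec_mulVec,
      Cop_mul_Bop hq hc hw z.ne_zero z'.ne_zero hne, e, div_neg, div_self hbq,
      Matrix.add_mulVec, Matrix.smul_mulVec, Matrix.sub_mulVec, ← Matrix.mulVec_mulVec,
      ← Matrix.mulVec_mulVec, ← Matrix.mulVec_mulVec, Cop_mulVec_vac hq, Dop_mulVec_vac hq,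
      Dop_mulVec_vac hq, hd z' (by simp), zero_smul, Matrix.mulVec_zero, Matrix.mulVec_zero,
      Matrix.mulVec_smul, Aop_mulVec_vac hq]
    module
  | insert x s hx ih =>
    have hxz' : x ≠ z' := fun h => hz' (by simp [h])
    have hzx : z ≠ x := fun h => hz (by simp [h])
    have hx' : x ∉ insert z' s := by simp [hxz', hx]
    have hzs : z ∉ insert z' s := fun h => hz (by
      rw [Finset.insert_comm]; exact Finset.mem_insert_of_mem h)
    have hz's : z' ∉ s := fun h => hz' (Finset.mem_insert_of_mem h)
    have hd' : ∀ u ∈ insert z' s, ∏ j, br (q⁻¹ * u / w j) = 0 := fun u hu => hd u (by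
      rw [Finset.insert_comm]; exact Finset.mem_insert_of_mem hu)
    have hsub : ∀ u ∈ insert z (insert z' s), u ∈ insert z (insert z' (insert x s)) := by
      intro u hu
      simp only [Finset.mem_insert] at hu ⊢
      tauto
    have hsub' : ∀ u ∈ insert x (insert z' s), u ∈ insert z (insert z' (insert x s)) := by
      intro u hu
      simp only [Finset.mem_insert] at hu ⊢
      tauto
    have hDz : Dop q c w z *ᵥ betheOn hq hq4 hc hw (insert z' s) = 0 := by
      refine Dop_mulVec_betheOn_eq_zero hq hq4 hc hw _ z hzs
        (fun u hu v hv => hs u (hsub u hu) v (hsub v hv)) hd' ?_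
      rw [Finset.prod_insert hz's, ← hzz, div_self z'.ne_zero, br_one, zero_mul, mul_zero]
    have hDx : Dop q c w x *ᵥ betheOn hq hq4 hc hw (insert z' s) = 0 := by
      refine Dop_mulVec_betheOn_eq_zero hq hq4 hc hw _ x hx'
        (fun u hu v hv => hs u (hsub' u hu) v (hsub' v hv)) hd' ?_
      rw [hd x (by simp), zero_mul]
    rw [Finset.insert_comm, betheOn_insert hq hq4 hc hw hx', Matrix.mulVec_mulVec,
      Cop_mul_Bop hq hc hw z.ne_zero x.ne_zero (hs z (by simp) x (by simp) hzx),
      Matrix.add_mulVec, Matrix.smul_mulVec, Matrix.sub_mulVec, ← Matrix.mulVec_mulVec,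
      ← Matrix.mulVec_mulVec, ← Matrix.mulVec_mulVec, hDz, hDx, Matrix.mulVec_zero,
      Matrix.mulVec_zero, sub_zero, smul_zero, add_zero,
      ih hz's hzs (fun u hu v hv => hs u (hsub u hu) v (hsub v hv)) hd', Matrix.mulVec_smul,
      ← betheOn_insert hq hq4 hc hw hx]

lemma pairing_shifted (hq : q ≠ 0) (hq4 : q ^ 4 ≠ 1) (hc : c ^ 2 = br q * br (q ^ 2))
    (hw : ∀ j, w j ≠ 0) (h1 : ∀ j k : Fin N, j ≠ k → w j ^ 2 ≠ w k ^ 2)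
    (h2 : ∀ j k : Fin N, q ^ 2 * w j ^ 2 ≠ w k ^ 2) :
    pairing hq hq4 hc hw (Finset.univ.image fun j => Units.mk0 q hq * unitsOf hw j) =
      ∏ j, (-1) ^ N * ((∏ l, br (q ^ 2 * w j / w l)) * ∏ l, br (q⁻¹ * w j / w l)) := by
  set y : Fin N → ℂˣ := fun j => Units.mk0 q hq * unitsOf hw j with hy
  have hyv : ∀ j, (y j : ℂ) = q * w j := fun j => rfl
  have hinj : Function.Injective y := fun j k h => unitsOf_injective hw h1 (mul_left_cancel h)
  have hne : ∀ j k, unitsOf hw j ≠ y k := by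
    intro j k h
    apply h2 k j
    have := congrArg Units.val h
    rw [hyv] at this
    change w j = _ at this
    rw [this]
    ring
  have key : ∀ l : List (Fin N), l.Nodup →
      (l.map fun j => Bop q c (fun j => (w j)⁻¹) (w j)⁻¹).prod *ᵥ vac N ⬝ᵥ
        betheOn hq hq4 hc hw (l.map y).toFinset =
      (l.map fun j => (-1) ^ N * ((∏ l, br (q ^ 2 * w j / w l)) *
        ∏ l, br (q⁻¹ * w j / w l))).prod := by
    intro l hl
    induction l with
    | nil =>
      have : betheOn hq hq4 hc hw ∅ = vac N := offShell_empty ..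
      simp [this, vac, dotProduct]
    | cons j l ih =>
      obtain ⟨hj, hl⟩ := List.nodup_cons.1 hl
      have hj' : y j ∉ (l.map y).toFinset := by
        simp only [List.mem_toFinset, List.mem_map, not_exists, not_and]
        intro k hk e
        exact hj (hinj e ▸ hk)
      have hC := Cop_mulVec_betheOn hq hq4 hc hw (z := unitsOf hw j) (z' := y j) rfl
        (l.map y).toFinset hj' ?_ ?_ ?_
      · rw [List.map_cons, List.map_cons, List.map_cons, List.prod_cons, List.prod_cons,
          List.toFinset_cons, ← ih hl, Bop_inv hq, ← Matrix.mulVec_mulVec, Matrix.smul_mulVec,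
          smul_dotProduct, Matrix.mulVec_transpose, ← Matrix.dotProduct_mulVec]
        change _ • (_ ⬝ᵥ Cop q c w (unitsOf hw j : ℂ) *ᵥ _) = _
        rw [hC, dotProduct_smul, hyv, smul_smul, smul_eq_mul]
        congr 1
        simp only [← mul_assoc q q, ← sq]
        change (-1) ^ (N + 1) * -((∏ l, br (q ^ 2 * w j / w l)) * ∏ l, br (q⁻¹ * w j / w l)) = _
        ring
      · simp only [Finset.mem_insert, List.mem_toFinset, List.mem_map, not_or, not_exists, not_and]
        exact ⟨hne j j, fun k _ e => hne j k e.symm⟩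
      · have hmem : ∀ u ∈ insert (unitsOf hw j) (insert (y j) (l.map y).toFinset),
            u = unitsOf hw j ∨ ∃ k, u = y k := by
          intro u hu
          simp only [Finset.mem_insert, List.mem_toFinset, List.mem_map] at hu
          rcases hu with h | h | ⟨k, _, h⟩
          · exact Or.inl h
          · exact Or.inr ⟨j, h⟩
          · exact Or.inr ⟨k, h.symm⟩
        intro u hu v hv huv
        refine br_div_ne_zero u.ne_zero v.ne_zero ?_
        rcases hmem u hu with rfl | ⟨k, rfl⟩ <;> rcases hmem v hv with rfl | ⟨m, rfl⟩
        · exact absurd rfl huv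
        · rw [hyv, mul_pow]; exact (h2 m j).symm
        · rw [hyv, mul_pow]; exact h2 k j
        · rw [hyv, hyv, mul_pow, mul_pow]
          exact fun e => h1 k m (fun e => huv (e ▸ rfl)) (mul_left_cancel₀ (pow_ne_zero 2 hq) e)
      · intro u hu
        have : ∃ k, u = y k := by
          simp only [Finset.mem_insert, List.mem_toFinset, List.mem_map] at hu
          rcases hu with h | ⟨k, _, h⟩
          · exact ⟨j, h⟩
          · exact ⟨k, h.symm⟩
        obtain ⟨k, rfl⟩ := this
        refine Finset.prod_eq_zero (Finset.mem_univ k) ?_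
        rw [hyv, inv_mul_cancel_left₀ hq, div_self (hw k), br_one]
  have h := key _ (List.nodup_finRange N)
  have e : ((List.finRange N).map y).toFinset = Finset.univ.image y := by
    ext; simp
  rw [e, ← List.ofFn_eq_map (f := fun j => (-1) ^ N * ((∏ l, br (q ^ 2 * w j / w l)) *
        ∏ l, br (q⁻¹ * w j / w l))), List.prod_ofFn] at h
  exact h

end Evaluation

section Assembly
variable {N : ℕ} {q c : ℂ} {w : Fin N → ℂ}

lemma prod_prod_erase_eq_prod_lt {M : Type*} [CommMonoid M] (f : Fin N → Fin N → M) :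
    ∏ i, ∏ l ∈ Finset.univ.erase i, f i l =
      ∏ pr ∈ Finset.univ.filter (fun pr : Fin N × Fin N => pr.1 < pr.2),
        f pr.1 pr.2 * f pr.2 pr.1 := by
  have h : ∀ i, ∏ l ∈ Finset.univ.erase i, f i l =
      (∏ l, if i < l then f i l else 1) * ∏ l, if l < i then f i l else 1 := by
    intro i
    rw [← Finset.prod_mul_distrib, ← Finset.mul_prod_erase _ _ (Finset.mem_univ i)]
    simp only [lt_irrefl, if_false, one_mul]
    refine Finset.prod_congr rfl fun l hl => ?_
    rcases lt_or_gt_of_ne (Finset.ne_of_mem_erase hl) with h | h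
    · simp [h, h.not_gt]
    · simp [h, h.not_gt]
  rw [Finset.prod_congr rfl fun i _ => h i, Finset.prod_mul_distrib, Finset.prod_filter,
    Fintype.prod_prod_type]
  conv_lhs => rw [mul_comm, Finset.prod_comm, mul_comm]
  rw [← Finset.prod_mul_distrib]
  refine Finset.prod_congr rfl fun i _ => ?_
  rw [← Finset.prod_mul_distrib]
  refine Finset.prod_congr rfl fun l _ => ?_
  split_ifs <;> simp

lemma prod_pOff_mul_pairing (hq : q ≠ 0) (hq4 : q ^ 4 ≠ 1) (hc : c ^ 2 = br q * br (q ^ 2))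
    (hw : ∀ j, w j ≠ 0) (h1 : ∀ j k : Fin N, j ≠ k → w j ^ 2 ≠ w k ^ 2)
    (h2 : ∀ j k : Fin N, q ^ 2 * w j ^ 2 ≠ w k ^ 2)
    (h3 : ∀ j k : Fin N, j ≠ k → q ^ 4 * w j ^ 2 ≠ w k ^ 2) :
    (∏ i, pOff q w i (q * w i)) * pairing hq hq4 hc hw (Finset.univ.image (unitsOf hw)) =
      (Matrix.of fun i k => pOff q w i (w k)).det *
        pairing hq hq4 hc hw (Finset.univ.image fun j => Units.mk0 q hq * unitsOf hw j) := by
  set y : Fin N → ℂˣ := fun j => Units.mk0 q hq * unitsOf hw j with hy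
  have hyv : ∀ j, (y j : ℂ) = q * w j := fun j => rfl
  have hvv : ∀ j, (unitsOf hw j : ℂ) = w j := fun j => rfl
  have hsq : ∀ u ∈ Set.range (unitsOf hw) ∪ Set.range y,
      ∀ v ∈ Set.range (unitsOf hw) ∪ Set.range y, u ≠ v → br ((u : ℂ) / v) ≠ 0 := by
    intro u hu v hv huv
    refine br_div_ne_zero u.ne_zero v.ne_zero ?_
    rcases hu with ⟨j, rfl⟩ | ⟨j, rfl⟩ <;> rcases hv with ⟨k, rfl⟩ | ⟨k, rfl⟩
    · exact h1 j k fun e => huv (e ▸ rfl)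
    · rw [hyv, mul_pow]; exact (h2 k j).symm
    · rw [hyv, mul_pow]; exact h2 j k
    · rw [hyv, hyv, mul_pow, mul_pow]
      exact fun e => h1 j k (fun e => huv (e ▸ rfl)) (mul_left_cancel₀ (pow_ne_zero 2 hq) e)
  have hsymm : symVandermonde y = symVandermonde (unitsOf hw) := symVandermonde_smul _ _
  have hne : symVandermonde (unitsOf hw) ≠ 0 := symVandermonde_ne_zero fun j k h => by
    by_contra hjk
    exact h1 j k hjk h
  have := prod_mul_eq_det_mul (Set.range (unitsOf hw) ∪ Set.range y)
    (fun i u => pOff q w i (u : ℂ)) y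
    (fun v => pairing hq hq4 hc hw (Finset.univ.image v) * symVandermonde v)
    (fun i => Or.inr ⟨i, rfl⟩) ?_ ?_ ?_ ?_ (unitsOf hw) (unitsOf_injective hw h1)
    (fun k => Or.inl ⟨k, rfl⟩)
  · simp only [hsymm, ← mul_assoc] at this
    exact mul_right_cancel₀ hne this
  · intro i l hil
    refine Finset.prod_eq_zero (Finset.mem_erase.2 ⟨hil.symm, Finset.mem_univ l⟩) ?_
    rw [hyv, inv_mul_cancel_left₀ hq, div_self (hw l), br_one, mul_zero]
  · intro i
    refine Finset.prod_ne_zero_iff.2 fun l hl => ?_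
    have hil := (Finset.ne_of_mem_erase hl).symm
    rw [hyv, inv_mul_cancel_left₀ hq]
    refine mul_ne_zero (br_div_ne_zero (mul_ne_zero hq (mul_ne_zero hq (hw i))) (hw l) ?_)
      (br_div_ne_zero (hw i) (hw l) (h1 i l hil))
    intro e
    apply h3 i l hil
    rw [← e]
    ring
  · intro σ
    have e : Finset.univ.image (y ∘ σ) = Finset.univ.image y := by
      ext u
      simp only [Finset.mem_image, Finset.mem_univ, true_and, Function.comp]
      exact ⟨fun ⟨a, h⟩ => ⟨σ a, h⟩, fun ⟨a, h⟩ => ⟨σ.symm a, by simpa using h⟩⟩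
    rw [e, symVandermonde_comp_perm]
    ring
  · intro v hv hvG i hi
    exact pairing_exchange hq hq4 hc hw h1 hv hi (fun k l h => hsq _ (hvG k) _ (hvG l) h)
      (fun k => hsq _ (Or.inr ⟨i, rfl⟩) _ (hvG k) fun e => hi ⟨k, e.symm⟩) i

lemma br_mul_div_swap (x y z : ℂ) : br (x⁻¹ * y / z) = -br (x * z / y) := by
  rw [← br_inv]
  congr 1
  rw [inv_div]
  ring

lemma det_pOff_mul (hq : q ≠ 0)
    (hw : ∀ j, w j ≠ 0) (h1 : ∀ j k : Fin N, j ≠ k → w j ^ 2 ≠ w k ^ 2)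
    (h2 : ∀ j k : Fin N, q ^ 2 * w j ^ 2 ≠ w k ^ 2) :
    (Matrix.of fun i k => pOff q w i (w k)).det * br (q ^ 2) ^ N =
      ZIK q w w * ∏ i, ∏ l ∈ Finset.univ.erase i, br (w i / w l) := by
  have hA : ∀ j k, br (q * w j / w k) ≠ 0 := fun j k =>
    br_div_ne_zero (mul_ne_zero hq (hw j)) (hw k) (by rw [mul_pow]; exact h2 j k)
  have hV : ∏ i, ∏ l ∈ Finset.univ.erase i, br (w i / w l) ≠ 0 :=
    Finset.prod_ne_zero_iff.2 fun i _ => Finset.prod_ne_zero_iff.2 fun l hl =>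
      br_div_ne_zero (hw i) (hw l) (h1 i l (Finset.ne_of_mem_erase hl).symm)
  set r : Fin N → ℂ := fun k => -∏ l, br (q * w k / w l) * br (q⁻¹ * w k / w l) with hr
  have hr' : ∏ k, r k = ∏ j, ∏ k, br (q * w j / w k) * br (q * w k / w j) := by
    have e : ∀ k, r k = (-1) ^ (N + 1) * ∏ l, br (q * w k / w l) * br (q * w l / w k) := by
      intro k
      simp only [hr, br_mul_div_swap, mul_neg]
      rw [Finset.prod_neg, Finset.card_fin]
      ring
    rw [Finset.prod_congr rfl fun k _ => e k, Finset.prod_mul_distrib, Finset.prod_const,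
      Finset.card_fin, ← pow_mul, mul_comm (N + 1) N,
      Even.neg_one_pow (Nat.even_mul_succ_self N), one_mul]
  have hp : (br (q ^ 2)) • (Matrix.of fun i k => pOff q w i (w k)) =
      Matrix.of fun i k => r k * (Matrix.of fun j k : Fin N =>
        br (q ^ 2) / (br (q * w j / w k) * br (q * w k / w j))) i k := by
    ext i k
    simp only [Matrix.smul_apply, Matrix.of_apply, smul_eq_mul, hr, pOff]
    rw [← Finset.mul_prod_erase _ _ (Finset.mem_univ i), br_mul_div_swap q (w k) (w i)]
    have := hA i k
    have := hA k i
    field_simp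
  have hd := congrArg Matrix.det hp
  rw [Matrix.det_smul, Matrix.det_mul_row, Fintype.card_fin, hr'] at hd
  rw [mul_comm, hd, ZIK, prod_prod_erase_eq_prod_lt]
  rw [prod_prod_erase_eq_prod_lt] at hV
  field_simp

/-- The scalar product formula, before normalisation and for generic inhomogeneities. -/
lemma bethe_inv_dotProduct_bethe_of_generic (hq : q ≠ 0) (hq4 : q ^ 4 ≠ 1)
    (hc : c ^ 2 = br q * br (q ^ 2))
    (hw : ∀ j, w j ≠ 0) (h1 : ∀ j k : Fin N, j ≠ k → w j ^ 2 ≠ w k ^ 2)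
    (h2 : ∀ j k : Fin N, q ^ 2 * w j ^ 2 ≠ w k ^ 2)
    (h3 : ∀ j k : Fin N, j ≠ k → q ^ 4 * w j ^ 2 ≠ w k ^ 2) :
    (bethe q c (fun j => (w j)⁻¹) ⬝ᵥ bethe q c w) * br (q ^ 2) ^ N =
      ZIK q w w * (c ^ 2) ^ N *
        ∏ pr ∈ Finset.univ.filter (fun pr : Fin N × Fin N => pr.1 < pr.2),
          br (q * w pr.1 / w pr.2) * br (q * w pr.2 / w pr.1) := by
  have hV : ∏ i, ∏ l ∈ Finset.univ.erase i, br (w i / w l) ≠ 0 :=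
    Finset.prod_ne_zero_iff.2 fun i _ => Finset.prod_ne_zero_iff.2 fun l hl =>
      br_div_ne_zero (hw i) (hw l) (h1 i l (Finset.ne_of_mem_erase hl).symm)
  have hB : ∏ i, ∏ l ∈ Finset.univ.erase i, br (q ^ 2 * w i / w l) ≠ 0 :=
    Finset.prod_ne_zero_iff.2 fun i _ => Finset.prod_ne_zero_iff.2 fun l hl =>
      br_div_ne_zero (mul_ne_zero (pow_ne_zero 2 hq) (hw i)) (hw l) (by
        rw [mul_pow, ← pow_mul]; exact h3 i l (Finset.ne_of_mem_erase hl).symm)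
  have hP : ∏ i, pOff q w i (q * w i) =
      (∏ i, ∏ l ∈ Finset.univ.erase i, br (q ^ 2 * w i / w l)) *
        ∏ i, ∏ l ∈ Finset.univ.erase i, br (w i / w l) := by
    simp only [pOff, inv_mul_cancel_left₀ hq, ← mul_assoc q q, ← sq, Finset.prod_mul_distrib]
  have hY : pairing hq hq4 hc hw (Finset.univ.image fun j => Units.mk0 q hq * unitsOf hw j) =
      (c ^ 2) ^ N * ((∏ i, ∏ l ∈ Finset.univ.erase i, br (q ^ 2 * w i / w l)) *
        ∏ i, ∏ l ∈ Finset.univ.erase i, br (q * w i / w l)) := by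
    have e : ∀ j, (-1) ^ N * ((∏ l, br (q ^ 2 * w j / w l)) * ∏ l, br (q⁻¹ * w j / w l)) =
        c ^ 2 * ((∏ l ∈ Finset.univ.erase j, br (q ^ 2 * w j / w l)) *
          ∏ l ∈ Finset.univ.erase j, br (q * w l / w j)) := by
      intro j
      simp only [br_mul_div_swap]
      rw [Finset.prod_neg, Finset.card_fin,
        ← Finset.mul_prod_erase Finset.univ (fun l => br (q ^ 2 * w j / w l)) (Finset.mem_univ j),
        ← Finset.mul_prod_erase Finset.univ (fun l => br (q * w l / w j)) (Finset.mem_univ j),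
        mul_div_cancel_right₀ _ (hw j), mul_div_cancel_right₀ _ (hw j), hc]
      have : ((-1 : ℂ) ^ N) * (-1) ^ N = 1 := by rw [← mul_pow]; simp
      linear_combination (br q * br (q ^ 2) * ((∏ l ∈ Finset.univ.erase j, br (q ^ 2 * w j / w l)) *
          ∏ l ∈ Finset.univ.erase j, br (q * w l / w j))) * this
    rw [pairing_shifted hq hq4 hc hw h1 h2, Finset.prod_congr rfl fun j _ => e j,
      Finset.prod_mul_distrib, Finset.prod_mul_distrib, Finset.prod_const, Finset.card_fin,
      prod_prod_erase_eq_prod_lt fun i l => br (q * w l / w i),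
      prod_prod_erase_eq_prod_lt fun i l => br (q * w i / w l)]
    congr 2
    exact Finset.prod_congr rfl fun _ _ => mul_comm _ _
  have h := prod_pOff_mul_pairing hq hq4 hc hw h1 h2 h3
  have hdet := det_pOff_mul hq hw h1 h2
  rw [hP, hY] at h
  rw [bethe_eq_betheOn hq hq4 hc hw h1, ← prod_prod_erase_eq_prod_lt
    fun i l => br (q * w i / w l)]
  change pairing hq hq4 hc hw _ * _ = _
  apply mul_left_cancel₀ (mul_ne_zero hB hV)
  linear_combination (br (q ^ 2) ^ N) * h + ((c ^ 2) ^ N *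
    ((∏ i, ∏ l ∈ Finset.univ.erase i, br (q ^ 2 * w i / w l)) *
        ∏ i, ∏ l ∈ Finset.univ.erase i, br (q * w i / w l))) * hdet

lemma ZIK_continuousAt {α : Type*} [TopologicalSpace α] {a : α} (hq : q ≠ 0)
    {w : α → Fin N → ℂ} (hw : ∀ j, ContinuousAt (fun t => w t j) a) (hw0 : ∀ j, w a j ≠ 0)
    (h1 : ∀ j k : Fin N, j ≠ k → w a j ^ 2 ≠ w a k ^ 2)
    (h2 : ∀ j k : Fin N, q ^ 2 * w a j ^ 2 ≠ w a k ^ 2) :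
    ContinuousAt (fun t => ZIK q (w t) (w t)) a := by
  have hquot : ∀ j k, ContinuousAt (fun t => br (w t j / w t k)) a := fun j k =>
    br_continuousAt ((hw j).div (hw k) (hw0 k)) (div_ne_zero (hw0 j) (hw0 k))
  have hA : ∀ j k, ContinuousAt (fun t => br (q * w t j / w t k)) a := fun j k =>
    br_continuousAt ((continuousAt_const.mul (hw j)).div (hw k) (hw0 k))
      (div_ne_zero (mul_ne_zero hq (hw0 j)) (hw0 k))
  have hne : ∀ j k, br (q * w a j / w a k) ≠ 0 := fun j k =>
    br_div_ne_zero (mul_ne_zero hq (hw0 j)) (hw0 k) (by rw [mul_pow]; exact h2 j k)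
  refine ContinuousAt.mul (ContinuousAt.div ?_ ?_ ?_) ?_
  · exact tendsto_finsetProd _ fun j _ => tendsto_finsetProd _ fun k _ => (hA j k).mul (hA k j)
  · exact tendsto_finsetProd _ fun pr _ => (hquot pr.1 pr.2).mul (hquot pr.2 pr.1)
  · refine Finset.prod_ne_zero_iff.2 fun pr hpr => ?_
    have h := (Finset.mem_filter.1 hpr).2.ne
    exact mul_ne_zero (br_div_ne_zero (hw0 _) (hw0 _) (h1 _ _ h))
      (br_div_ne_zero (hw0 _) (hw0 _) (h1 _ _ h.symm))
  · simp only [Matrix.det_apply]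
    exact tendsto_finsetSum _ fun σ _ => (tendsto_finsetProd _ fun j _ =>
      (continuousAt_const (y := br (q ^ 2))).div ((hA _ _).mul (hA _ _))
        (mul_ne_zero (hne _ _) (hne _ _))).const_smul _

lemma bethe_inv_dotProduct_bethe (hq : q ≠ 0) (hq4 : q ^ 4 ≠ 1)
    (hc : c ^ 2 = br q * br (q ^ 2))
    (hw : ∀ j, w j ≠ 0) (h1 : ∀ j k : Fin N, j ≠ k → w j ^ 2 ≠ w k ^ 2)
    (h2 : ∀ j k : Fin N, q ^ 2 * w j ^ 2 ≠ w k ^ 2) :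
    (bethe q c (fun j => (w j)⁻¹) ⬝ᵥ bethe q c w) * br (q ^ 2) ^ N =
      ZIK q w w * (c ^ 2) ^ N *
        ∏ pr ∈ Finset.univ.filter (fun pr : Fin N × Fin N => pr.1 < pr.2),
          br (q * w pr.1 / w pr.2) * br (q * w pr.2 / w pr.1) := by
  set W : ℝ → Fin N → ℂ := fun t j => w j * (((1 + t) ^ (j : ℕ) : ℝ) : ℂ) with hW
  have hW0 : W 0 = w := by
    funext j
    simp [hW]
  have hWc : ∀ j, ContinuousAt (fun t => W t j) 0 := fun j => by
    simp only [hW]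
    fun_prop
  have hw0 : ∀ j, W 0 j ≠ 0 := fun j => by rw [hW0]; exact hw j
  have hc1 := bethe_continuousAt (c := c) hq (w := fun t j => (W t j)⁻¹)
    (fun j => (hWc j).inv₀ (hw0 j)) fun j => inv_ne_zero (hw0 j)
  have hc2 := bethe_continuousAt (c := c) hq hWc hw0
  have hA : ∀ j k, ContinuousAt (fun t => br (q * W t j / W t k)) 0 := fun j k =>
    br_continuousAt ((continuousAt_const.mul (hWc j)).div (hWc k) (hw0 k))
      (div_ne_zero (mul_ne_zero hq (hw0 j)) (hw0 k))
  have hL : ContinuousAt (fun t => (bethe q c (fun j => (W t j)⁻¹) ⬝ᵥ bethe q c (W t)) *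
      br (q ^ 2) ^ N) 0 :=
    ContinuousAt.mul (tendsto_finsetSum _ fun σ _ =>
      ((continuousAt_pi.1 hc1 σ).mul (continuousAt_pi.1 hc2 σ))) continuousAt_const
  have hR : ContinuousAt (fun t => ZIK q (W t) (W t) * (c ^ 2) ^ N *
        ∏ pr ∈ Finset.univ.filter (fun pr : Fin N × Fin N => pr.1 < pr.2),
          br (q * W t pr.1 / W t pr.2) * br (q * W t pr.2 / W t pr.1)) 0 :=
    ((ZIK_continuousAt hq hWc hw0 (by rwa [hW0]) (by rwa [hW0])).mul continuousAt_const).mul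
      (tendsto_finsetProd _ fun pr _ => (hA _ _).mul (hA _ _))
  have hev : ∀ (b : ℂ) (j k : Fin N), b * w j ^ 2 ≠ w k ^ 2 →
      ∀ᶠ t in nhdsWithin (0 : ℝ) (Set.Ioi 0), b * W t j ^ 2 ≠ W t k ^ 2 := by
    intro b j k h
    have hd : ContinuousAt (fun t => b * W t j ^ 2 - W t k ^ 2) 0 :=
      (continuousAt_const.mul ((hWc j).pow 2)).sub ((hWc k).pow 2)
    have hd0 : b * W 0 j ^ 2 - W 0 k ^ 2 ≠ 0 := by rw [hW0]; exact sub_ne_zero.2 h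
    exact ((hd.eventually_ne hd0).filter_mono nhdsWithin_le_nhds).mono fun t ht =>
      sub_ne_zero.1 ht
  have hev3 : ∀ j k : Fin N, j ≠ k →
      ∀ᶠ t in nhdsWithin (0 : ℝ) (Set.Ioi 0), q ^ 4 * W t j ^ 2 ≠ W t k ^ 2 := by
    intro j k hjk
    by_cases h : q ^ 4 * w j ^ 2 = w k ^ 2
    · filter_upwards [self_mem_nhdsWithin] with t ht e
      have ht : 0 < t := ht
      simp only [hW, mul_pow] at e
      rw [← mul_assoc, h] at e
      have e := mul_left_cancel₀ (pow_ne_zero 2 (hw k)) e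
      have e : (((1 + t) ^ (j : ℕ) : ℝ)) ^ 2 = (((1 + t) ^ (k : ℕ) : ℝ)) ^ 2 := by
        exact_mod_cast e
      rw [← pow_mul, ← pow_mul] at e
      have := pow_right_injective₀ (a := 1 + t) (by linarith) (by linarith) e
      exact hjk (Fin.ext (by simpa using this))
    · exact hev _ j k h
  have heq : (fun t => (bethe q c (fun j => (W t j)⁻¹) ⬝ᵥ bethe q c (W t)) *
      br (q ^ 2) ^ N) =ᶠ[nhdsWithin (0 : ℝ) (Set.Ioi 0)]
      fun t => ZIK q (W t) (W t) * (c ^ 2) ^ N *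
        ∏ pr ∈ Finset.univ.filter (fun pr : Fin N × Fin N => pr.1 < pr.2),
          br (q * W t pr.1 / W t pr.2) * br (q * W t pr.2 / W t pr.1) := by
    have e1 : ∀ᶠ t in nhdsWithin (0 : ℝ) (Set.Ioi 0), ∀ j k : Fin N, j ≠ k →
        W t j ^ 2 ≠ W t k ^ 2 := by
      simp only [Filter.eventually_all]
      intro j k hjk
      simpa using hev 1 j k (by simpa using h1 j k hjk)
    have e2 : ∀ᶠ t in nhdsWithin (0 : ℝ) (Set.Ioi 0), ∀ j k : Fin N,
        q ^ 2 * W t j ^ 2 ≠ W t k ^ 2 := by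
      simp only [Filter.eventually_all]
      exact fun j k => hev _ j k (h2 j k)
    have e3 : ∀ᶠ t in nhdsWithin (0 : ℝ) (Set.Ioi 0), ∀ j k : Fin N, j ≠ k →
        q ^ 4 * W t j ^ 2 ≠ W t k ^ 2 := by
      simp only [Filter.eventually_all]
      exact hev3
    filter_upwards [e1, e2, e3, self_mem_nhdsWithin] with t h1 h2 h3 ht
    have ht : 0 < t := ht
    refine bethe_inv_dotProduct_bethe_of_generic hq hq4 hc (fun j => ?_) h1 h2 h3
    exact mul_ne_zero (hw j) (Complex.ofReal_ne_zero.2 (pow_ne_zero _ (by linarith)))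
  have := tendsto_nhds_unique_of_eventuallyEq (hL.tendsto.mono_left nhdsWithin_le_nhds)
    (hR.tendsto.mono_left nhdsWithin_le_nhds) heq
  simpa only [hW0] using this

end Assembly

/-- Sum rule: the bilinear square norm of the renormalised Bethe vector equals
`[q²]^{−N} Z_IK(w₁,…,w_N; w₁,…,w_N)`. -/
theorem stmt16 (q c : ℂ) (hq : q ≠ 0) (hq4 : q^4 ≠ 1) (hc : c^2 = br q * br (q^2))
    (N : ℕ) (hN : 1 ≤ N) (w : Fin N → ℂ) (hw : ∀ j, w j ≠ 0)
    (h1 : ∀ j k : Fin N, j ≠ k → w j ^ 2 ≠ w k ^ 2)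
    (h2 : ∀ j k : Fin N, j ≠ k → q^2 * w j ^ 2 ≠ w k ^ 2) :
    ∑ σ : Fin N → Fin 3,
        betheTilde q c (fun j => (w j)⁻¹) σ * betheTilde q c w σ =
      (br (q^2) ^ N)⁻¹ * ZIK q w w := by
  have hq2 : q ^ 2 ≠ 1 := fun h => hq4 (by rw [show 4 = 2 * 2 from rfl, pow_mul, h, one_pow])
  have hbq2 : br (q ^ 2) ≠ 0 := br_ne_zero (pow_ne_zero 2 hq) (by rwa [← pow_mul])
  have hc0 : c ≠ 0 := fun h => mul_ne_zero (br_ne_zero hq hq2) hbq2 (by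
    rw [← hc, h, zero_pow two_ne_zero])
  have h2' : ∀ j k : Fin N, q ^ 2 * w j ^ 2 ≠ w k ^ 2 := by
    intro j k
    by_cases hjk : j = k
    · subst hjk
      exact fun h => hq2 (mul_right_cancel₀ (pow_ne_zero 2 (hw j)) (h.trans (one_mul _).symm))
    · exact h2 j k hjk
  have hA : ∀ j k, br (q * w j / w k) ≠ 0 := fun j k =>
    br_div_ne_zero (mul_ne_zero hq (hw j)) (hw k) (by rw [mul_pow]; exact h2' j k)
  have h := bethe_inv_dotProduct_bethe hq hq4 hc hw h1 h2'
  rw [Finset.prod_mul_distrib] at h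
  have hP : ∏ pr ∈ Finset.univ.filter (fun pr : Fin N × Fin N => pr.1 < pr.2),
      br (q * w pr.1 / w pr.2) ≠ 0 := Finset.prod_ne_zero_iff.2 fun _ _ => hA _ _
  have hP' : ∏ pr ∈ Finset.univ.filter (fun pr : Fin N × Fin N => pr.1 < pr.2),
      br (q * w pr.2 / w pr.1) ≠ 0 := Finset.prod_ne_zero_iff.2 fun _ _ => hA _ _
  have hinv : ∀ j k, q * (w j)⁻¹ / (w k)⁻¹ = q * w k / w j := fun j k => by
    rw [div_inv_eq_mul]
    ring
  change betheTilde q c (fun j => (w j)⁻¹) ⬝ᵥ betheTilde q c w = _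
  simp only [betheTilde, hinv, smul_dotProduct, dotProduct_smul, smul_eq_mul]
  rw [eq_inv_mul_iff_mul_eq₀ (pow_ne_zero N hbq2)]
  generalize (bethe q c fun j => (w j)⁻¹) ⬝ᵥ bethe q c w = b at h ⊢
  field_simp
  linear_combination h

end
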